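/- arXiv:1811.02023 — 2 statements merged into one kernel-verified Lean document; each statement's English description precedes it below -/
import Mathlib

section
/- The space of orderons is sequentially compact with respect to the cut-shift distance: for every sequence {W_n}_{n∈ℕ} of orderons there exist a subsequence {W_{n_k}} and an orderon U such that d△(W_{n_k}, U) → 0 as k → ∞. -/
open MeasureTheory Real Filter
open scoped ENNReal Classical

noncomputable section

/-- The unit interval `[0,1]` as a subtype of `ℝ`. -/
abbrev UI : Type := Set.Icc (0:ℝ) 1

/-- The unit square `[0,1]²`. -/
abbrev USq : Type := UI × UI

/-- An orderon: a symmetric measurable function `([0,1]²)² → [0,1]`. -/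
def IsOrderon (W : USq → USq → ℝ) : Prop :=
  Measurable (Function.uncurry W) ∧ (∀ u v, W u v ∈ Set.Icc (0:ℝ) 1) ∧
    ∀ u v, W u v = W v u

/-- The (unordered) cut norm: `sup_{S,T} |∫_{S×T} W|` over measurable `S,T ⊆ [0,1]²`. -/
def cutNorm (W : USq → USq → ℝ) : ℝ :=
  sSup {x | ∃ S T : Set USq, MeasurableSet S ∧ MeasurableSet T ∧
    x = |∫ p in S ×ˢ T, W p.1 p.2|}

/-- A measure-preserving bijection of `[0,1]²` with measure-preserving inverse. -/
def IsMPB (f : USq → USq) : Prop :=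
  MeasurePreserving f volume volume ∧
  ∃ g : USq → USq, MeasurePreserving g volume volume ∧
    Function.LeftInverse g f ∧ Function.RightInverse g f

/-- `Shift(f) = sup_{(x,a)} |x - π₁(f(x,a))|`. -/
def shiftOf (f : USq → USq) : ℝ := ⨆ u : USq, |(u.1 : ℝ) - ((f u).1 : ℝ)|

/-- The cut-shift distance `d△(W,U) = inf_f (Shift(f) + ‖W - U^f‖_□)`. -/
def csDist (W U : USq → USq → ℝ) : ℝ :=
  sInf {x | ∃ f : USq → USq, IsMPB f ∧
    x = shiftOf f + cutNorm (fun u v => W u v - U (f u) (f v))}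

lemma integrable_of_measurable_of_abs_le {α : Type*} [MeasurableSpace α] {μ : Measure α}
    [IsFiniteMeasure μ] {f : α → ℝ} (hf : Measurable f) {C : ℝ} (hC : ∀ x, |f x| ≤ C) :
    Integrable f μ :=
  Integrable.of_bound hf.aestronglyMeasurable C (ae_of_all _ fun x => by simpa using hC x)

/-- Weak regularity: a bounded kernel is close in cut norm to a combination of boundedly many
measurable rectangles with bounded coefficients. -/
lemma exists_rectangles_approx {Ω : Type*} [MeasurableSpace Ω] (P : Measure Ω)
    [IsProbabilityMeasure P] {ε : ℝ} (hε : 0 < ε) (m : ℕ) (R : Ω × Ω → ℝ) (hR : Measurable R)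
    (hb : ∃ C, ∀ p, |R p| ≤ C) (h1 : ∫ p, R p ^ 2 ∂(P.prod P) ≤ 1)
    (hm : ∫ p, R p ^ 2 ∂(P.prod P) < m * ε ^ 2) :
    ∃ (c : ℕ → ℝ) (S T : ℕ → Set Ω), (∀ i, |c i| ≤ 1) ∧ (∀ i, MeasurableSet (S i)) ∧
      (∀ i, MeasurableSet (T i)) ∧ ∀ A B : Set Ω, MeasurableSet A → MeasurableSet B →
        |∫ p in A ×ˢ B, (R p - ∑ i ∈ Finset.range m, c i * (S i ×ˢ T i).indicator 1 p)
          ∂(P.prod P)| ≤ ε := by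
  induction m generalizing R with
  | zero =>
    have : 0 ≤ ∫ p, R p ^ 2 ∂(P.prod P) := integral_nonneg fun p => sq_nonneg _
    simp at hm
    linarith
  | succ m ih =>
    by_cases hgood : ∀ A B : Set Ω, MeasurableSet A → MeasurableSet B →
        |∫ p in A ×ˢ B, R p ∂(P.prod P)| ≤ ε
    · exact ⟨fun _ => 0, fun _ => ∅, fun _ => ∅, by simp, by simp, by simp, by simpa using hgood⟩
    push Not at hgood
    obtain ⟨A, B, hA, hB, hAB⟩ := hgood
    obtain ⟨C, hC⟩ := hb
    set t := ∫ p in A ×ˢ B, R p ∂(P.prod P) with ht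
    have hmeas : MeasurableSet (A ×ˢ B) := hA.prod hB
    have hind : Measurable ((A ×ˢ B).indicator (1 : Ω × Ω → ℝ)) :=
      measurable_one.indicator hmeas
    have hind_le : ∀ p, |(A ×ˢ B).indicator (1 : Ω × Ω → ℝ) p| ≤ 1 := fun p => by
      by_cases hp : p ∈ A ×ˢ B <;> simp [hp]
    set R' : Ω × Ω → ℝ := fun p => R p - t * (A ×ˢ B).indicator 1 p with hR'
    have hR'm : Measurable R' := hR.sub (hind.const_mul t)
    have hR'b : ∀ p, |R' p| ≤ C + |t| := fun p => by
      refine (abs_sub _ _).trans (add_le_add (hC p) ?_)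
      rw [abs_mul]
      exact mul_le_of_le_one_right (abs_nonneg _) (hind_le p)
    have hR2 : Integrable (fun p => R p ^ 2) (P.prod P) :=
      integrable_of_measurable_of_abs_le (C := C ^ 2) (hR.pow_const 2) fun p => by
        rw [abs_pow]; gcongr; exact hC p
    have hRint : Integrable R (P.prod P) := integrable_of_measurable_of_abs_le hR hC
    have hRind : Integrable ((A ×ˢ B).indicator R) (P.prod P) := hRint.indicator hmeas
    have hoind : Integrable ((A ×ˢ B).indicator (1 : Ω × Ω → ℝ)) (P.prod P) :=
      integrable_of_measurable_of_abs_le hind hind_le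
    have hkey : ∫ p, R' p ^ 2 ∂(P.prod P) ≤ ∫ p, R p ^ 2 ∂(P.prod P) - t ^ 2 := by
      have e1 : ∀ p, R' p ^ 2 = R p ^ 2 - 2 * t * (A ×ˢ B).indicator R p
          + t ^ 2 * (A ×ˢ B).indicator 1 p := fun p => by
        by_cases hp : p ∈ A ×ˢ B
        · simp only [hR', Set.indicator_of_mem hp, Pi.one_apply]; ring
        · simp only [hR', Set.indicator_of_notMem hp]; ring
      have e2 : ∫ p, (A ×ˢ B).indicator (1 : Ω × Ω → ℝ) p ∂(P.prod P) ≤ 1 := by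
        rw [integral_indicator_one hmeas]
        exact measureReal_le_one
      simp_rw [e1]
      have hd : Integrable (fun p => R p ^ 2 - 2 * t * (A ×ˢ B).indicator R p) (P.prod P) :=
        hR2.sub (hRind.const_mul _)
      rw [integral_add hd (hoind.const_mul _),
        integral_sub hR2 (hRind.const_mul _), integral_const_mul, integral_const_mul,
        integral_indicator hmeas, ← ht]
      nlinarith [sq_nonneg t, mul_le_mul_of_nonneg_left e2 (sq_nonneg t)]
    have hpos : 0 ≤ ∫ p, R' p ^ 2 ∂(P.prod P) := integral_nonneg fun p => sq_nonneg _
    have ht2 : ε ^ 2 ≤ t ^ 2 := by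
      rw [← sq_abs t]; gcongr
    have ht1 : |t| ≤ 1 := by
      rw [← sq_le_one_iff_abs_le_one]; linarith
    obtain ⟨c, S, T, hc, hS, hT, h⟩ := ih R' hR'm ⟨_, hR'b⟩ (by nlinarith [sq_nonneg t])
      (by push_cast at hm; nlinarith)
    refine ⟨fun i => Nat.casesOn i t c, fun i => Nat.casesOn i A S, fun i => Nat.casesOn i B T,
      ?_, ?_, ?_, fun A' B' hA' hB' => ?_⟩
    · rintro (_ | i); exacts [ht1, hc i]
    · rintro (_ | i); exacts [hA, hS i]
    · rintro (_ | i); exacts [hB, hT i]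
    · refine le_of_eq_of_le ?_ (h A' B' hA' hB')
      congr 2
      ext p
      rw [Finset.sum_range_succ', sub_add_eq_sub_sub_swap]
      rfl

lemma exists_integral_mul_le {Ω Ω' X : Type*} [MeasurableSpace Ω] [MeasurableSpace Ω']
    [MeasurableSpace X] (P : Measure Ω) [IsProbabilityMeasure P] (P' : Measure Ω')
    [IsProbabilityMeasure P'] {Ψ : Ω → X} (hΨ : Measurable Ψ) {Φ : X × Ω' → ℝ}
    (hΦ : Measurable Φ) {C : ℝ} (hC : ∀ p, |Φ p| ≤ C) {g : Ω → ℝ} (hg : Measurable g)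
    (hg01 : ∀ u, g u ∈ Set.Icc (0 : ℝ) 1) :
    ∃ S : Set X, MeasurableSet S ∧ ∫ p, g p.1 * Φ (Ψ p.1, p.2) ∂(P.prod P') ≤
      ∫ p, S.indicator 1 (Ψ p.1) * Φ (Ψ p.1, p.2) ∂(P.prod P') := by
  set G : X → ℝ := fun x => ∫ v, Φ (x, v) ∂P' with hG
  have hGm : Measurable G := (hΦ.stronglyMeasurable.integral_prod_right').measurable
  have hC0 : 0 ≤ C := (abs_nonneg _).trans
    (hC (Ψ (Classical.choice P.nonempty_of_neZero), Classical.choice P'.nonempty_of_neZero))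
  have hSm : MeasurableSet {x | 0 < G x} := measurableSet_lt measurable_const hGm
  have hGC : ∀ x, |G x| ≤ C := fun x => by
    simpa using norm_integral_le_of_norm_le_const (μ := P') (f := fun v => Φ (x, v)) (C := C)
      (ae_of_all _ fun v => by simpa using hC (x, v))
  have hΦΨ : Measurable fun p : Ω × Ω' => Φ (Ψ p.1, p.2) :=
    hΦ.comp ((hΨ.comp measurable_fst).prodMk measurable_snd)
  have key : ∀ k : Ω → ℝ, Measurable k → (∀ u, k u ∈ Set.Icc (0 : ℝ) 1) →
      Integrable (fun u => k u * G (Ψ u)) P ∧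
      ∫ p, k p.1 * Φ (Ψ p.1, p.2) ∂(P.prod P') = ∫ u, k u * G (Ψ u) ∂P := fun k hk hk01 => by
    constructor
    · refine integrable_of_measurable_of_abs_le (C := C) (hk.mul (hGm.comp hΨ)) fun u => ?_
      rw [abs_mul, abs_of_nonneg (hk01 u).1]
      exact (mul_le_of_le_one_left (abs_nonneg _) (hk01 u).2).trans (hGC _)
    · rw [integral_prod]
      · simp_rw [integral_const_mul]; rfl
      · refine integrable_of_measurable_of_abs_le (C := C)
          ((hk.comp measurable_fst).mul hΦΨ) fun u => ?_
        rw [abs_mul, abs_of_nonneg (hk01 _).1]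
        exact (mul_le_of_le_one_left (abs_nonneg _) (hk01 _).2).trans (hC _)
  have hI : ∀ u, ({x | 0 < G x}.indicator (1 : X → ℝ) (Ψ u)) ∈ Set.Icc (0 : ℝ) 1 := fun u => by
    by_cases h : Ψ u ∈ {x | 0 < G x} <;> simp [h]
  have k1 := key g hg hg01
  have k2 := key (fun u => {x | 0 < G x}.indicator 1 (Ψ u))
    ((measurable_one.indicator hSm).comp hΨ) hI
  refine ⟨_, hSm, ?_⟩
  rw [k1.2, k2.2]
  refine integral_mono k1.1 k2.1 fun u => ?_
  by_cases h : 0 < G (Ψ u)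
  · simp only [Set.indicator, Set.mem_ofPred_eq, h, if_true, Pi.one_apply]
    exact mul_le_mul_of_nonneg_right (hg01 u).2 h.le
  · simp only [Set.indicator, Set.mem_ofPred_eq, h, if_false, zero_mul]
    exact mul_nonpos_of_nonneg_of_nonpos (hg01 u).1 (not_lt.1 h)

lemma exists_integral_mul_mul_le {Ω X : Type*} [MeasurableSpace Ω] [MeasurableSpace X]
    (P : Measure Ω) [IsProbabilityMeasure P] {Ψ : Ω → X} (hΨ : Measurable Ψ) {Φ : X × X → ℝ}
    (hΦ : Measurable Φ) {C : ℝ} (hC : ∀ p, |Φ p| ≤ C) {g h : Ω → ℝ} (hg : Measurable g)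
    (hg01 : ∀ u, g u ∈ Set.Icc (0 : ℝ) 1) (hh : Measurable h)
    (hh01 : ∀ u, h u ∈ Set.Icc (0 : ℝ) 1) :
    ∃ S T : Set X, MeasurableSet S ∧ MeasurableSet T ∧
      ∫ p, g p.1 * h p.2 * Φ (Ψ p.1, Ψ p.2) ∂(P.prod P) ≤
        ∫ p in S ×ˢ T, Φ p ∂((P.map Ψ).prod (P.map Ψ)) := by
  obtain ⟨S, hS, h1⟩ := exists_integral_mul_le P P hΨ
    (Φ := fun p : X × Ω => h p.2 * Φ (p.1, Ψ p.2)) (C := C) (by fun_prop) (fun p => by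
      rw [abs_mul, abs_of_nonneg (hh01 _).1]
      exact (mul_le_of_le_one_left (abs_nonneg _) (hh01 _).2).trans (hC _)) hg hg01
  have hSi : Measurable (S.indicator (1 : X → ℝ)) := measurable_one.indicator hS
  obtain ⟨T, hT, h2⟩ := exists_integral_mul_le P P hΨ
    (Φ := fun p : X × Ω => S.indicator 1 (Ψ p.2) * Φ (Ψ p.2, p.1)) (C := C)
      (by fun_prop) (fun p => by
      have : |S.indicator (1 : X → ℝ) (Ψ p.2)| ≤ 1 := by
        by_cases h : Ψ p.2 ∈ S <;> simp [h]
      rw [abs_mul]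
      exact (mul_le_of_le_one_left (abs_nonneg _) this).trans (hC _)) hh hh01
  have hTi : Measurable (T.indicator (1 : X → ℝ)) := measurable_one.indicator hT
  refine ⟨S, T, hS, hT, ?_⟩
  calc ∫ p, g p.1 * h p.2 * Φ (Ψ p.1, Ψ p.2) ∂(P.prod P)
      = ∫ p, g p.1 * (h p.2 * Φ (Ψ p.1, Ψ p.2)) ∂(P.prod P) := by simp_rw [mul_assoc]
    _ ≤ _ := h1
    _ = ∫ p, h p.1 * (S.indicator 1 (Ψ p.2) * Φ (Ψ p.2, Ψ p.1)) ∂(P.prod P) := by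
      rw [← integral_prod_swap]
      refine integral_congr_ae (ae_of_all _ fun p => ?_)
      simp only [Prod.fst_swap, Prod.snd_swap]
      ring
    _ ≤ _ := h2
    _ = ∫ p, (S ×ˢ T).indicator Φ (Ψ p.1, Ψ p.2) ∂(P.prod P) := by
      rw [← integral_prod_swap]
      refine integral_congr_ae (ae_of_all _ fun p => ?_)
      by_cases hS : Ψ p.1 ∈ S <;> by_cases hT : Ψ p.2 ∈ T <;>
        simp [Set.indicator, hS, hT]
    _ = _ := by
      rw [Measure.map_prod_map _ _ hΨ hΨ, ← integral_indicator (hS.prod hT), integral_map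
        (hΨ.prodMap hΨ).aemeasurable (hΦ.indicator (hS.prod hT)).aestronglyMeasurable]
      rfl

lemma abs_integral_mul_mul_le {Ω X : Type*} [MeasurableSpace Ω] [MeasurableSpace X]
    (P : Measure Ω) [IsProbabilityMeasure P] {Ψ : Ω → X} (hΨ : Measurable Ψ) {Φ : X × X → ℝ}
    (hΦ : Measurable Φ) {C : ℝ} (hC : ∀ p, |Φ p| ≤ C) {ε : ℝ}
    (hε : ∀ S T : Set X, MeasurableSet S → MeasurableSet T →
      |∫ p in S ×ˢ T, Φ p ∂((P.map Ψ).prod (P.map Ψ))| ≤ ε)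
    {g h : Ω → ℝ} (hg : Measurable g)
    (hg01 : ∀ u, g u ∈ Set.Icc (0 : ℝ) 1) (hh : Measurable h)
    (hh01 : ∀ u, h u ∈ Set.Icc (0 : ℝ) 1) :
    |∫ p, g p.1 * h p.2 * Φ (Ψ p.1, Ψ p.2) ∂(P.prod P)| ≤ ε := by
  refine abs_le'.2 ⟨?_, ?_⟩
  · obtain ⟨S, T, hS, hT, h⟩ := exists_integral_mul_mul_le P hΨ hΦ hC hg hg01 hh hh01
    exact h.trans ((le_abs_self _).trans (hε S T hS hT))
  · obtain ⟨S, T, hS, hT, h⟩ := exists_integral_mul_mul_le P hΨ hΦ.neg (C := C)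
      (by simpa using hC) hg hg01 hh hh01
    simp only [Pi.neg_apply, mul_neg, integral_neg] at h
    exact h.trans ((neg_le_abs _).trans (hε S T hS hT))

lemma exists_continuous_approx_indicator {X : Type*} [TopologicalSpace X] [MeasurableSpace X]
    [NormalSpace X] [BorelSpace X] (μ : Measure X) [IsProbabilityMeasure μ] [μ.WeaklyRegular]
    {S : Set X} (hS : MeasurableSet S) {δ : ℝ} (hδ : 0 < δ) :
    ∃ g : X → ℝ, Continuous g ∧ (∀ x, g x ∈ Set.Icc (0 : ℝ) 1) ∧
      ∫ x, |S.indicator 1 x - g x| ∂μ ≤ δ := by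
  have hi : Integrable (S.indicator (1 : X → ℝ)) μ := (integrable_const 1).indicator hS
  obtain ⟨g, hg, hgi⟩ := hi.exists_boundedContinuous_integral_sub_le hδ
  have hc : Continuous fun x => max 0 (min 1 (g x)) := by fun_prop
  have h01 : ∀ x, max 0 (min 1 (g x)) ∈ Set.Icc (0 : ℝ) 1 := fun x =>
    ⟨le_max_left _ _, max_le zero_le_one (min_le_left _ _)⟩
  refine ⟨_, hc, h01, le_trans (integral_mono ?_ (hi.sub hgi).norm fun x => ?_) hg⟩
  · refine (hi.sub ?_).norm
    exact Integrable.of_bound hc.aestronglyMeasurable 1 (ae_of_all _ fun x => by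
      rw [Real.norm_eq_abs, abs_of_nonneg (h01 x).1]; exact (h01 x).2)
  · have hs : S.indicator (1 : X → ℝ) x = max 0 (min 1 (S.indicator (1 : X → ℝ) x)) := by
      by_cases h : x ∈ S <;> simp [h]
    simp only [Real.norm_eq_abs, Pi.sub_apply]
    conv_lhs => rw [hs]
    refine (abs_max_sub_max_le_max _ _ _ _).trans ?_
    rw [sub_self, abs_zero, max_eq_right (abs_nonneg _)]
    refine (abs_min_sub_min_le_max _ _ _ _).trans ?_
    rw [sub_self, abs_zero, max_eq_right (abs_nonneg _)]

lemma abs_setIntegral_prod_le_of_continuous {X : Type*} [TopologicalSpace X] [MeasurableSpace X]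
    [NormalSpace X] [BorelSpace X] (μ : Measure X) [IsProbabilityMeasure μ] [μ.WeaklyRegular]
    {Φ : X × X → ℝ} (hΦ : Measurable Φ) {C : ℝ} (hC : ∀ p, |Φ p| ≤ C) {ε : ℝ}
    (hε : ∀ g h : X → ℝ, Continuous g → Continuous h → (∀ x, g x ∈ Set.Icc (0 : ℝ) 1) →
      (∀ x, h x ∈ Set.Icc (0 : ℝ) 1) → |∫ p, g p.1 * h p.2 * Φ p ∂(μ.prod μ)| ≤ ε)
    {S T : Set X} (hS : MeasurableSet S) (hT : MeasurableSet T) :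
    |∫ p in S ×ˢ T, Φ p ∂(μ.prod μ)| ≤ ε := by
  have hC0 : 0 ≤ C := by
    have x := Classical.choice μ.nonempty_of_neZero
    exact (abs_nonneg _).trans (hC (x, x))
  refine le_of_forall_pos_le_add fun η hη => ?_
  set δ := η / (2 * (C + 1)) with hδ
  have hδ0 : 0 < δ := by positivity
  obtain ⟨g, hg, hg01, hgS⟩ := exists_continuous_approx_indicator μ hS hδ0
  obtain ⟨h, hh, hh01, hhT⟩ := exists_continuous_approx_indicator μ hT hδ0
  have hSi : Measurable (S.indicator (1 : X → ℝ)) := measurable_one.indicator hS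
  have hTi : Measurable (T.indicator (1 : X → ℝ)) := measurable_one.indicator hT
  have hgm := hg.measurable
  have hhm := hh.measurable
  have hSb : ∀ x, S.indicator (1 : X → ℝ) x ∈ Set.Icc (0 : ℝ) 1 := fun x => by
    by_cases h : x ∈ S <;> simp [h]
  have hTb : ∀ x, T.indicator (1 : X → ℝ) x ∈ Set.Icc (0 : ℝ) 1 := fun x => by
    by_cases h : x ∈ T <;> simp [h]
  have hint : ∀ a b : X → ℝ, Measurable a → Measurable b → (∀ x, a x ∈ Set.Icc (0 : ℝ) 1) →
      (∀ x, b x ∈ Set.Icc (0 : ℝ) 1) →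
      Integrable (fun p : X × X => a p.1 * b p.2 * Φ p) (μ.prod μ) := fun a b ha hb ha1 hb1 => by
    refine integrable_of_measurable_of_abs_le (C := C) (by fun_prop) fun p => ?_
    rw [abs_mul, abs_mul, abs_of_nonneg (ha1 _).1, abs_of_nonneg (hb1 _).1]
    exact (mul_le_of_le_one_left (abs_nonneg _)
      (mul_le_one₀ (ha1 _).2 (hb1 _).1 (hb1 _).2)).trans (hC _)
  have hdist : ∀ a b : X → ℝ, Measurable a → Measurable b → (∀ x, a x ∈ Set.Icc (0 : ℝ) 1) →
      (∀ x, b x ∈ Set.Icc (0 : ℝ) 1) → Integrable (fun x => |a x - b x|) μ :=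
    fun a b ha hb ha1 hb1 => by
    refine integrable_of_measurable_of_abs_le (C := 1) (by fun_prop) fun x => ?_
    rw [abs_abs, abs_le]
    constructor <;> linarith [(ha1 x).1, (ha1 x).2, (hb1 x).1, (hb1 x).2]
  have e1 : ∫ p in S ×ˢ T, Φ p ∂(μ.prod μ) =
      ∫ p, S.indicator 1 p.1 * T.indicator 1 p.2 * Φ p ∂(μ.prod μ) := by
    rw [← integral_indicator (hS.prod hT)]
    refine integral_congr_ae (ae_of_all _ fun p => ?_)
    by_cases hS : p.1 ∈ S <;> by_cases hT : p.2 ∈ T <;> simp [Set.indicator, hS, hT]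
  have e2 : |∫ p, S.indicator 1 p.1 * T.indicator 1 p.2 * Φ p ∂(μ.prod μ) -
      ∫ p, g p.1 * h p.2 * Φ p ∂(μ.prod μ)| ≤ η := by
    rw [← integral_sub (hint _ _ hSi hTi hSb hTb) (hint _ _ hgm hhm hg01 hh01)]
    have i1 : Integrable (fun p : X × X => |S.indicator 1 p.1 - g p.1|) (μ.prod μ) :=
      (hdist _ _ hSi hgm hSb hg01).comp_fst μ
    have i2 : Integrable (fun p : X × X => |T.indicator 1 p.2 - h p.2|) (μ.prod μ) :=
      (hdist _ _ hTi hhm hTb hh01).comp_snd μ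
    calc _ ≤ ∫ p, C * (|S.indicator 1 p.1 - g p.1| + |T.indicator 1 p.2 - h p.2|)
          ∂(μ.prod μ) := by
          rw [← Real.norm_eq_abs]
          refine norm_integral_le_of_norm_le ((i1.add i2).const_mul C) (ae_of_all _ fun p => ?_)
          rw [Real.norm_eq_abs, ← sub_mul, abs_mul, mul_comm]
          refine mul_le_mul (hC p) ?_ (abs_nonneg _) hC0
          have : S.indicator 1 p.1 * T.indicator 1 p.2 - g p.1 * h p.2 =
            (S.indicator 1 p.1 - g p.1) * T.indicator 1 p.2 +
              g p.1 * (T.indicator 1 p.2 - h p.2) := by ring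
          rw [this]
          refine (abs_add_le _ _).trans (add_le_add ?_ ?_)
          · rw [abs_mul, abs_of_nonneg (hTb _).1]
            exact mul_le_of_le_one_right (abs_nonneg _) (hTb _).2
          · rw [abs_mul, abs_of_nonneg (hg01 _).1]
            exact mul_le_of_le_one_left (abs_nonneg _) (hg01 _).2
      _ = C * (∫ x, |S.indicator 1 x - g x| ∂μ + ∫ x, |T.indicator 1 x - h x| ∂μ) := by
          rw [integral_const_mul, integral_add i1 i2,
            integral_fun_fst (fun x : X => |S.indicator 1 x - g x|),
            integral_fun_snd (fun x : X => |T.indicator 1 x - h x|)]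
          simp
      _ ≤ C * (δ + δ) := by gcongr
      _ ≤ (C + 1) * (δ + δ) := by gcongr; linarith
      _ = η := by rw [hδ]; field_simp; ring
  rw [e1]
  have := hε g h hg hh hg01 hh01
  rw [abs_le] at *
  constructor <;> linarith [e2.1, e2.2, this.1, this.2]
lemma ProbabilityMeasure.tendsto_integral_of_continuous {X : Type*} [TopologicalSpace X]
    [CompactSpace X] [MeasurableSpace X] [OpensMeasurableSpace X] {μs : ℕ → ProbabilityMeasure X}
    {μ : ProbabilityMeasure X} (h : Tendsto μs atTop (nhds μ)) {f : X → ℝ} (hf : Continuous f) :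
    Tendsto (fun n => ∫ x, f x ∂(μs n : Measure X)) atTop (nhds (∫ x, f x ∂(μ : Measure X))) :=
  ProbabilityMeasure.tendsto_iff_forall_integral_tendsto.1 h
    (BoundedContinuousFunction.mkOfCompact ⟨f, hf⟩)

/-- The kernel `∑ c i * e i false x * e i true y` of finite rank. -/
def finRankKernel {X : Type*} (m : ℕ) (c : ℕ → ℝ) (e : ℕ → Bool → X → ℝ) (p : X × X) : ℝ :=
  ∑ i ∈ Finset.range m, c i * (e i false p.1 * e i true p.2)

lemma abs_finRankKernel_le {X : Type*} {m : ℕ} {c : ℕ → ℝ} {e : ℕ → Bool → X → ℝ}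
    (hc : ∀ i, |c i| ≤ 1) (he : ∀ i b x, e i b x ∈ Set.Icc (0 : ℝ) 1) (p : X × X) :
    |finRankKernel m c e p| ≤ m := by
  calc |finRankKernel m c e p| ≤ ∑ i ∈ Finset.range m, 1 := by
        refine (Finset.abs_sum_le_sum_abs _ _).trans (Finset.sum_le_sum fun i _ => ?_)
        have h1 := he i false p.1
        have h2 := he i true p.2
        rw [abs_mul, abs_of_nonneg (mul_nonneg h1.1 h2.1)]
        exact mul_le_one₀ (hc i) (mul_nonneg h1.1 h2.1) (mul_le_one₀ h1.2 h2.1 h2.2)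
    _ = m := by simp

lemma abs_finRankKernel_sub_le {X : Type*} {m : ℕ} {c a : ℕ → ℝ} {e : ℕ → Bool → X → ℝ}
    (he : ∀ i b x, e i b x ∈ Set.Icc (0 : ℝ) 1) (p : X × X) :
    |finRankKernel m c e p - finRankKernel m a e p| ≤ ∑ i ∈ Finset.range m, |c i - a i| := by
  rw [finRankKernel, finRankKernel, ← Finset.sum_sub_distrib]
  refine (Finset.abs_sum_le_sum_abs _ _).trans (Finset.sum_le_sum fun i _ => ?_)
  have h1 := he i false p.1
  have h2 := he i true p.2
  rw [← sub_mul, abs_mul, abs_of_nonneg (mul_nonneg h1.1 h2.1)]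
  exact mul_le_of_le_one_right (abs_nonneg _) (mul_le_one₀ h1.2 h2.1 h2.2)

lemma measurable_finRankKernel {X : Type*} [MeasurableSpace X] (m : ℕ) (c : ℕ → ℝ)
    {e : ℕ → Bool → X → ℝ} (he : ∀ i b, Measurable (e i b)) :
    Measurable (finRankKernel m c e) :=
  Finset.measurable_sum _ fun i _ => (((he i false).comp measurable_fst).mul
    ((he i true).comp measurable_snd)).const_mul _

lemma integral_mul_finRankKernel_sub {Ω X : Type*} [MeasurableSpace Ω] [MeasurableSpace X]
    (P : Measure Ω) [IsProbabilityMeasure P] {Ψ : Ω → X} (hΨ : Measurable Ψ) (m : ℕ) (c : ℕ → ℝ)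
    {e : ℕ → Bool → X → ℝ} (he : ∀ i b, Measurable (e i b))
    (he01 : ∀ i b x, e i b x ∈ Set.Icc (0 : ℝ) 1) {W : Ω × Ω → ℝ} (hW : Measurable W)
    (hW01 : ∀ p, W p ∈ Set.Icc (0 : ℝ) 1) {g h : X → ℝ} (hg : Measurable g)
    (hg01 : ∀ x, g x ∈ Set.Icc (0 : ℝ) 1) (hh : Measurable h)
    (hh01 : ∀ x, h x ∈ Set.Icc (0 : ℝ) 1) :
    ∫ p, g (Ψ p.1) * h (Ψ p.2) * (finRankKernel m c e (Ψ p.1, Ψ p.2) - W p) ∂(P.prod P) =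
      ∑ i ∈ Finset.range m, c i * ((∫ x, g x * e i false x ∂(P.map Ψ)) *
        ∫ x, h x * e i true x ∂(P.map Ψ)) -
      ∫ p, g (Ψ p.1) * h (Ψ p.2) * W p ∂(P.prod P) := by
  have hmul : ∀ {s t : ℝ}, s ∈ Set.Icc (0 : ℝ) 1 → t ∈ Set.Icc (0 : ℝ) 1 →
      s * t ∈ Set.Icc (0 : ℝ) 1 := fun hs ht =>
    ⟨mul_nonneg hs.1 ht.1, mul_le_one₀ hs.2 ht.1 ht.2⟩
  have hint : ∀ {f : Ω × Ω → ℝ}, Measurable f → (∀ p, f p ∈ Set.Icc (0 : ℝ) 1) →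
      Integrable f (P.prod P) := fun hf hf01 =>
    integrable_of_measurable_of_abs_le (C := 1) hf fun p => by
      rw [abs_of_nonneg (hf01 p).1]; exact (hf01 p).2
  have hterm : ∀ i, Integrable (fun p : Ω × Ω => c i * ((g (Ψ p.1) * e i false (Ψ p.1)) *
      (h (Ψ p.2) * e i true (Ψ p.2)))) (P.prod P) := fun i =>
    (hint (by fun_prop) fun p => hmul (hmul (hg01 _) (he01 _ _ _))
      (hmul (hh01 _) (he01 _ _ _))).const_mul _
  have heq : ∀ p : Ω × Ω,
      g (Ψ p.1) * h (Ψ p.2) * (finRankKernel m c e (Ψ p.1, Ψ p.2) - W p) =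
      ∑ i ∈ Finset.range m, c i * ((g (Ψ p.1) * e i false (Ψ p.1)) *
        (h (Ψ p.2) * e i true (Ψ p.2))) - g (Ψ p.1) * h (Ψ p.2) * W p := fun p => by
    rw [finRankKernel, mul_sub, Finset.mul_sum]
    congr 1
    exact Finset.sum_congr rfl fun i _ => by ring
  simp_rw [heq]
  rw [integral_sub (integrable_finsetSum _ fun i _ => hterm i)
    (hint (by fun_prop) fun p => hmul (hmul (hg01 _) (hh01 _)) (hW01 p)),
    integral_finsetSum _ fun i _ => hterm i]
  congr 1
  refine Finset.sum_congr rfl fun i _ => ?_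
  rw [integral_const_mul, integral_prod_mul (fun u => g (Ψ u) * e i false (Ψ u))
    (fun u => h (Ψ u) * e i true (Ψ u)),
    integral_map (f := fun x => g x * e i false x) hΨ.aemeasurable
      (hg.mul (he i false)).aestronglyMeasurable,
    integral_map (f := fun x => h x * e i true x) hΨ.aemeasurable
      (hh.mul (he i true)).aestronglyMeasurable]

/-- Approximations of kernels by finite rank kernels pass to the limit. -/
lemma abs_setIntegral_finRankKernel_sub_le {Ω X : Type*} [MeasurableSpace Ω]
    (P : ProbabilityMeasure Ω) [TopologicalSpace X] [CompactSpace X]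
    [TopologicalSpace.MetrizableSpace X] [MeasurableSpace X] [BorelSpace X]
    {W : ℕ → Ω × Ω → ℝ} (hW : ∀ n, Measurable (W n))
    (hW01 : ∀ n p, W n p ∈ Set.Icc (0 : ℝ) 1)
    {Ψ : ℕ → Ω → X} (hΨ : ∀ n, Measurable (Ψ n)) {m : ℕ} {c : ℕ → ℕ → ℝ} {a : ℕ → ℝ}
    (hc : ∀ n i, |c n i| ≤ 1) (hca : ∀ i, Tendsto (fun n => c n i) atTop (nhds (a i)))
    {e : ℕ → Bool → X → ℝ} (he : ∀ i b, Continuous (e i b))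
    (he01 : ∀ i b x, e i b x ∈ Set.Icc (0 : ℝ) 1) {μ : ProbabilityMeasure X}
    (hμ : Tendsto (fun n => P.map (hΨ n).aemeasurable) atTop (nhds μ)) {V : X × X → ℝ}
    (hV : Measurable V) (hV01 : ∀ p, V p ∈ Set.Icc (0 : ℝ) 1)
    (hWV : ∀ g h : X → ℝ, Continuous g → Continuous h →
        Tendsto (fun n => ∫ p, g (Ψ n p.1) * h (Ψ n p.2) * W n p ∂((P : Measure Ω).prod P)) atTop
          (nhds (∫ p, g p.1 * h p.2 * V p ∂((μ : Measure X).prod μ)))) {ε : ℝ}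
    (hε : ∀ n (A B : Set Ω), MeasurableSet A → MeasurableSet B →
      |∫ p in A ×ˢ B, (finRankKernel m (c n) e (Ψ n p.1, Ψ n p.2) - W n p)
        ∂((P : Measure Ω).prod P)| ≤ ε) {S T : Set X} (hS : MeasurableSet S)
    (hT : MeasurableSet T) :
    |∫ p in S ×ˢ T, (finRankKernel m a e p - V p) ∂((μ : Measure X).prod μ)| ≤ ε := by
  let := TopologicalSpace.metrizableSpaceMetric X
  have ha : ∀ i, |a i| ≤ 1 := fun i =>
    le_of_tendsto (hca i).abs (Eventually.of_forall fun n => hc n i)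
  have hem : ∀ i b, Measurable (e i b) := fun i b => (he i b).measurable
  have hbound : ∀ {r v : ℝ}, |r| ≤ m → v ∈ Set.Icc (0 : ℝ) 1 → |r - v| ≤ m + 1 := fun hr hv =>
    (abs_sub _ _).trans (add_le_add hr (by rw [abs_of_nonneg hv.1]; exact hv.2))
  refine abs_setIntegral_prod_le_of_continuous (μ : Measure X)
    ((measurable_finRankKernel m a hem).sub hV)
    (fun p => hbound (abs_finRankKernel_le ha he01 p) (hV01 p)) (fun g h hg hh hg01 hh01 => ?_) hS hT
  have hlim := (tendsto_finsetSum (Finset.range m) fun i _ => (hca i).mul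
    ((ProbabilityMeasure.tendsto_integral_of_continuous hμ (hg.mul (he i false))).mul
      (ProbabilityMeasure.tendsto_integral_of_continuous hμ (hh.mul (he i true))))).sub
        (hWV g h hg hh)
  have e1 := integral_mul_finRankKernel_sub (μ : Measure X) measurable_id m a hem he01 hV hV01
    hg.measurable hg01 hh.measurable hh01
  rw [Measure.map_id] at e1
  simp only [id] at e1
  change |∫ p, g p.1 * h p.2 * (finRankKernel m a e (p.1, p.2) - V p) ∂_| ≤ ε
  rw [e1]
  refine le_of_tendsto hlim.abs (Eventually.of_forall fun n => ?_)
  have e2 := integral_mul_finRankKernel_sub (P : Measure Ω) (hΨ n) m (c n) hem he01 (hW n)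
    (hW01 n) hg.measurable hg01 hh.measurable hh01
  simp only [ProbabilityMeasure.toMeasure_map, Pi.mul_apply]
  rw [← e2]
  refine abs_integral_mul_mul_le (P : Measure Ω) measurable_id
    (Φ := fun p => finRankKernel m (c n) e (Ψ n p.1, Ψ n p.2) - W n p) (C := m + 1)
    (((measurable_finRankKernel m (c n) hem).comp
      (((hΨ n).comp measurable_fst).prodMk ((hΨ n).comp measurable_snd))).sub (hW n))
    (fun p => hbound (abs_finRankKernel_le (hc n) he01 _) (hW01 n p))
    (fun S T hS hT => ?_) (hg.measurable.comp (hΨ n)) (fun u => hg01 _)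
    (hh.measurable.comp (hΨ n)) (fun u => hh01 _)
  rw [Measure.map_id]
  exact hε n S T hS hT

/-- Compactness of coded kernels: along a subsequence, the laws of the codes converge weakly, and
the kernels converge against continuous functions of the codes to a kernel on the code space. -/
lemma exists_subseq_limit_kernel {Ω X : Type*} [MeasurableSpace Ω] (P : ProbabilityMeasure Ω)
    [TopologicalSpace X] [CompactSpace X] [TopologicalSpace.MetrizableSpace X]
    [MeasurableSpace X] [BorelSpace X]
    {W : ℕ → Ω → Ω → ℝ} (hW : ∀ n, Measurable (Function.uncurry (W n)))
    (hW01 : ∀ n u v, W n u v ∈ Set.Icc (0 : ℝ) 1) (hsymm : ∀ n u v, W n u v = W n v u)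
    {Ψ : ℕ → Ω → X} (hΨ : ∀ n, Measurable (Ψ n)) {ι : Type*} [Countable ι] {c : ℕ → ι → ℝ}
    (hc : ∀ n i, |c n i| ≤ 1) :
    ∃ φ : ℕ → ℕ, StrictMono φ ∧ ∃ (μ : ProbabilityMeasure X) (a : ι → ℝ) (V : X × X → ℝ),
      Measurable V ∧ (∀ p, V p ∈ Set.Icc (0 : ℝ) 1) ∧ (∀ x y, V (x, y) = V (y, x)) ∧
      Tendsto (fun n => P.map (hΨ (φ n)).aemeasurable) atTop (nhds μ) ∧
      (∀ i, Tendsto (fun n => c (φ n) i) atTop (nhds (a i))) ∧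
      ∀ g h : X → ℝ, Continuous g → Continuous h →
        Tendsto (fun n => ∫ p, g (Ψ (φ n) p.1) * h (Ψ (φ n) p.2) * W (φ n) p.1 p.2
          ∂((P : Measure Ω).prod P)) atTop
          (nhds (∫ p, g p.1 * h p.2 * V p ∂((μ : Measure X).prod μ))) := by
  let := TopologicalSpace.metrizableSpaceMetric X
  let F : ℕ → Ω × Ω → (X × X) × UI := fun n p => ((Ψ n p.1, Ψ n p.2), ⟨W n p.1 p.2, hW01 n _ _⟩)
  have hWp : ∀ n, Measurable fun p : Ω × Ω => W n p.1 p.2 := hW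
  have hF : ∀ n, Measurable (F n) := fun n =>
    (((hΨ n).comp measurable_fst).prodMk ((hΨ n).comp measurable_snd)).prodMk
      ((hWp n).subtype_mk)
  obtain ⟨⟨ρ, μ, a⟩, φ, hφ, hlim⟩ := CompactSpace.tendsto_subseq fun n =>
    ((((P.prod P).map (hF n).aemeasurable, P.map (hΨ n).aemeasurable,
      fun i => ⟨c n i, abs_le.1 (hc n i)⟩) :
      ProbabilityMeasure ((X × X) × UI) × ProbabilityMeasure X × (ι → Set.Icc (-1 : ℝ) 1)))
  have hρ := (continuous_fst.tendsto _).comp hlim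
  have hμ := ((continuous_fst.comp continuous_snd).tendsto _).comp hlim
  have ha : ∀ i, _ := fun i => ((continuous_subtype_val.comp
    ((continuous_apply i).comp (continuous_snd.comp continuous_snd))).tendsto _).comp hlim
  simp only [Function.comp_def] at hρ hμ ha
  have hfst : ρ.map (continuous_fst (X := X × X) (Y := UI)).measurable.aemeasurable
      = μ.prod μ := by
    refine tendsto_nhds_unique
      (ProbabilityMeasure.tendsto_map_of_tendsto_of_continuous _ _ hρ continuous_fst) ?_
    have := (ProbabilityMeasure.continuous_prod.tendsto (μ, μ)).comp (hμ.prodMk_nhds hμ)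
    refine this.congr fun n => ?_
    simp only [Function.comp_def]
    rw [ProbabilityMeasure.map_prod_map P P (hΨ _) (hΨ _)]
    apply Subtype.ext
    simp only [ProbabilityMeasure.val_eq_to_measure, ProbabilityMeasure.toMeasure_map]
    rw [Measure.map_map measurable_fst (hF _)]
    rfl
  have hfst' : (ρ : Measure ((X × X) × UI)).fst = (μ : Measure X).prod μ :=
    congrArg (fun ν : ProbabilityMeasure (X × X) => (ν : Measure (X × X))) hfst
  let V₀ : X × X → ℝ := fun z => ∫ w, (w : ℝ) ∂((ρ : Measure ((X × X) × UI)).condKernel z)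
  have hV₀m : Measurable V₀ :=
    (StronglyMeasurable.integral_kernel_prod_right' (f := fun p : (X × X) × UI => (p.2 : ℝ))
      (measurable_subtype_coe.comp measurable_snd).stronglyMeasurable).measurable
  have hV₀ : ∀ z, V₀ z ∈ Set.Icc (0 : ℝ) 1 := fun z => by
    refine ⟨integral_nonneg fun w => w.2.1, ?_⟩
    have := integral_mono (μ := (ρ : Measure ((X × X) × UI)).condKernel z)
      (integrable_of_measurable_of_abs_le (C := 1) measurable_subtype_coe
        fun w : UI => by rw [abs_of_nonneg w.2.1]; exact w.2.2)
      (integrable_const 1) fun w => w.2.2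
    simpa using this
  have hV₀lim : ∀ g h : X → ℝ, Continuous g → Continuous h →
        Tendsto (fun n => ∫ p, g (Ψ (φ n) p.1) * h (Ψ (φ n) p.2) * W (φ n) p.1 p.2
          ∂((P : Measure Ω).prod P)) atTop
          (nhds (∫ p, g p.1 * h p.2 * V₀ p ∂((μ : Measure X).prod μ))) := by
    intro g h hg hh
    have hcont : Continuous fun p : (X × X) × UI => g p.1.1 * h p.1.2 * (p.2 : ℝ) := by fun_prop
    have := ProbabilityMeasure.tendsto_integral_of_continuous hρ hcont
    have e : ∫ p, g p.1.1 * h p.1.2 * (p.2 : ℝ) ∂(ρ : Measure ((X × X) × UI)) =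
        ∫ p, g p.1 * h p.2 * V₀ p ∂((μ : Measure X).prod μ) := by
      rw [← Measure.integral_condKernel, hfst']
      · simp only [integral_const_mul, V₀]
      · exact (BoundedContinuousFunction.mkOfCompact ⟨_, hcont⟩).integrable _
    rw [e] at this
    refine this.congr fun n => ?_
    rw [ProbabilityMeasure.toMeasure_map, integral_map (hF _).aemeasurable
      hcont.aestronglyMeasurable]
    rfl
  have hint : ∀ g h : X → ℝ, Continuous g → Continuous h → ∀ V : X × X → ℝ, Measurable V →
      (∀ p, V p ∈ Set.Icc (0 : ℝ) 1) →
      Integrable (fun p => g p.1 * h p.2 * V p) ((μ : Measure X).prod μ) := by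
    intro g h hg hh V hV hV01
    have hcont : Continuous fun p : X × X => g p.1 * h p.2 := by fun_prop
    have hi : Integrable (fun p => g p.1 * h p.2) ((μ : Measure X).prod μ) :=
      (BoundedContinuousFunction.mkOfCompact ⟨_, hcont⟩).integrable _
    refine hi.mul_bdd (c := 1) hV.aestronglyMeasurable (ae_of_all _ fun p => ?_)
    rw [Real.norm_eq_abs, abs_of_nonneg (hV01 p).1]
    exact (hV01 p).2
  refine ⟨φ, hφ, μ, fun i => a i, fun p => (V₀ p + V₀ p.swap) / 2,
    (hV₀m.add (hV₀m.comp measurable_swap)).div_const 2, fun p => ?_, fun x y => ?_, hμ, ha, ?_⟩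
  · have h1 := hV₀ p
    have h2 := hV₀ p.swap
    constructor <;> linarith [h1.1, h1.2, h2.1, h2.2]
  · simp [add_comm]
  · intro g h hg hh
    have h1 := hV₀lim g h hg hh
    have h2 := hV₀lim h g hh hg
    have e1 : ∀ n, ∫ p, h (Ψ (φ n) p.1) * g (Ψ (φ n) p.2) * W (φ n) p.1 p.2
          ∂((P : Measure Ω).prod P) = ∫ p, g (Ψ (φ n) p.1) * h (Ψ (φ n) p.2) * W (φ n) p.1 p.2
          ∂((P : Measure Ω).prod P) := fun n => by
      rw [← integral_prod_swap]
      refine integral_congr_ae (ae_of_all _ fun p => ?_)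
      simp only [Prod.fst_swap, Prod.snd_swap]
      rw [hsymm, mul_comm (h _)]
    have e2 : ∫ p, h p.1 * g p.2 * V₀ p ∂((μ : Measure X).prod μ) =
        ∫ p, g p.1 * h p.2 * V₀ p.swap ∂((μ : Measure X).prod μ) := by
      rw [← integral_prod_swap]
      refine integral_congr_ae (ae_of_all _ fun p => ?_)
      simp only [Prod.fst_swap, Prod.snd_swap]
      rw [mul_comm (h _)]
    simp_rw [e1, e2] at h2
    have h3 := (h1.add h2).div_const 2
    refine (h3.congr fun n => by ring).trans_eq ?_
    congr 1
    rw [← integral_add (hint g h hg hh _ hV₀m hV₀)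
      (hint g h hg hh (fun p => V₀ p.swap) (hV₀m.comp measurable_swap) fun p => hV₀ _), ← integral_div]
    refine integral_congr_ae (ae_of_all _ fun p => ?_)
    ring

/-- The index of the cell of the `K × K` grid containing a point of the square. -/
def gridCell (K : ℕ) [NeZero K] (u : USq) : Fin K × Fin K :=
  (Fin.ofNat K ⌊K * (u.1 : ℝ)⌋₊, Fin.ofNat K ⌊K * (u.2 : ℝ)⌋₊)

/-- Translation of a coordinate from the grid interval `i` to the grid interval `j`. -/
def gridShift (K : ℕ) (i j : Fin K) (x : UI) : UI :=
  Set.projIcc 0 1 zero_le_one ((x : ℝ) + ((j : ℕ) - (i : ℕ) : ℝ) / K)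

/-- The bijection of the square that permutes the cells of the `K × K` grid by translations
and fixes the upper and right sides. -/
def gridPerm (K : ℕ) [NeZero K] (σ : Equiv.Perm (Fin K × Fin K)) (u : USq) : USq :=
  if u.1 < 1 ∧ u.2 < 1 then
    (gridShift K (gridCell K u).1 (σ (gridCell K u)).1 u.1,
      gridShift K (gridCell K u).2 (σ (gridCell K u)).2 u.2)
  else u

lemma measurable_gridCell (K : ℕ) [NeZero K] : Measurable (gridCell K) := by
  have h : Measurable (Fin.ofNat K) := Measurable.of_discrete
  exact (h.comp (Nat.measurable_floor.comp (by fun_prop))).prodMk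
    (h.comp (Nat.measurable_floor.comp (by fun_prop)))

lemma floor_lt_of_lt_one (K : ℕ) [NeZero K] {x : UI} (hx : x < 1) : ⌊K * (x : ℝ)⌋₊ < K := by
  have hK : (0 : ℝ) < K := Nat.cast_pos.2 (NeZero.pos K)
  rw [Nat.floor_lt (mul_nonneg hK.le x.2.1)]
  have : (x : ℝ) < 1 := hx
  nlinarith

lemma coe_gridShift (K : ℕ) [NeZero K] (j : Fin K) {x : UI} (hx : x < 1) :
    (gridShift K (Fin.ofNat K ⌊K * (x : ℝ)⌋₊) j x : ℝ) =
      x + ((j : ℕ) - (Fin.ofNat K ⌊K * (x : ℝ)⌋₊ : ℕ) : ℝ) / K := by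
  have hK : (0 : ℝ) < K := Nat.cast_pos.2 (NeZero.pos K)
  have hlt := floor_lt_of_lt_one K hx
  have h1 := Nat.floor_le (mul_nonneg hK.le x.2.1)
  have h2 := Nat.lt_floor_add_one (K * (x : ℝ))
  have hj : ((j : ℕ) : ℝ) + 1 ≤ K := by exact_mod_cast j.2
  have hj0 : (0 : ℝ) ≤ (j : ℕ) := Nat.cast_nonneg _
  rw [gridShift, Set.projIcc_of_mem]
  have e : (x : ℝ) + ((j : ℕ) - (Fin.ofNat K ⌊K * (x : ℝ)⌋₊ : ℕ) : ℝ) / K =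
      (K * x + ((j : ℕ) - (⌊K * (x : ℝ)⌋₊ : ℕ) : ℝ)) / K := by
    rw [Fin.val_ofNat, Nat.mod_eq_of_lt hlt]
    field_simp
  rw [e]
  constructor
  · apply div_nonneg _ hK.le; linarith
  · rw [div_le_one hK]; linarith

lemma ofNat_floor_gridShift (K : ℕ) [NeZero K] (j : Fin K) {x : UI} (hx : x < 1) :
    gridShift K (Fin.ofNat K ⌊K * (x : ℝ)⌋₊) j x < 1 ∧
    Fin.ofNat K ⌊K * (gridShift K (Fin.ofNat K ⌊K * (x : ℝ)⌋₊) j x : ℝ)⌋₊ = j := by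
  have hK : (0 : ℝ) < K := Nat.cast_pos.2 (NeZero.pos K)
  have hlt := floor_lt_of_lt_one K hx
  have h1 := Nat.floor_le (mul_nonneg hK.le x.2.1)
  have h2 := Nat.lt_floor_add_one (K * (x : ℝ))
  have hj : ((j : ℕ) : ℝ) + 1 ≤ K := by exact_mod_cast j.2
  have hj0 : (0 : ℝ) ≤ (j : ℕ) := Nat.cast_nonneg _
  have e : K * (gridShift K (Fin.ofNat K ⌊K * (x : ℝ)⌋₊) j x : ℝ) =
      K * x + ((j : ℕ) - (⌊K * (x : ℝ)⌋₊ : ℕ) : ℝ) := by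
    rw [coe_gridShift K j hx, Fin.val_ofNat, Nat.mod_eq_of_lt hlt]
    field_simp
  constructor
  · rw [← Subtype.coe_lt_coe]
    refine lt_of_mul_lt_mul_left (a := (K : ℝ)) ?_ hK.le
    rw [e]
    simp only [Set.Icc.coe_one]
    linarith
  · have : ⌊K * (gridShift K (Fin.ofNat K ⌊K * (x : ℝ)⌋₊) j x : ℝ)⌋₊ = j := by
      rw [e, Nat.floor_eq_iff (by linarith)]
      constructor <;> linarith
    rw [this]
    exact Fin.ext (by simp)

lemma gridCell_gridPerm (K : ℕ) [NeZero K] (σ : Equiv.Perm (Fin K × Fin K)) {u : USq}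
    (hu : u.1 < 1 ∧ u.2 < 1) :
    ((gridPerm K σ u).1 < 1 ∧ (gridPerm K σ u).2 < 1) ∧
      gridCell K (gridPerm K σ u) = σ (gridCell K u) := by
  have h1 := ofNat_floor_gridShift K (σ (gridCell K u)).1 hu.1
  have h2 := ofNat_floor_gridShift K (σ (gridCell K u)).2 hu.2
  rw [gridPerm, if_pos hu]
  exact ⟨⟨h1.1, h2.1⟩, Prod.ext h1.2 h2.2⟩

lemma coe_gridPerm (K : ℕ) [NeZero K] (σ : Equiv.Perm (Fin K × Fin K)) {u : USq}
    (hu : u.1 < 1 ∧ u.2 < 1) :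
    ((gridPerm K σ u).1 : ℝ) =
        u.1 + (((σ (gridCell K u)).1 : ℕ) - ((gridCell K u).1 : ℕ) : ℝ) / K ∧
      ((gridPerm K σ u).2 : ℝ) =
        u.2 + (((σ (gridCell K u)).2 : ℕ) - ((gridCell K u).2 : ℕ) : ℝ) / K := by
  rw [gridPerm, if_pos hu]
  exact ⟨coe_gridShift K _ hu.1, coe_gridShift K _ hu.2⟩

lemma gridPerm_leftInverse (K : ℕ) [NeZero K] {σ τ : Equiv.Perm (Fin K × Fin K)}
    (h : ∀ c, τ (σ c) = c) : Function.LeftInverse (gridPerm K τ) (gridPerm K σ) := by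
  intro u
  by_cases hu : u.1 < 1 ∧ u.2 < 1
  · have h1 := gridCell_gridPerm K σ hu
    have h2 := coe_gridPerm K σ hu
    have h3 := coe_gridPerm K τ h1.1
    rw [h1.2, h] at h3
    refine Prod.ext (Subtype.ext ?_) (Subtype.ext ?_)
    · rw [h3.1, h2.1]; ring
    · rw [h3.2, h2.2]; ring
  · have e : gridPerm K σ u = u := if_neg hu
    rw [e]
    exact if_neg hu

lemma measurableSet_interior_square : MeasurableSet {u : USq | u.1 < 1 ∧ u.2 < 1} :=
  (measurableSet_Iio.preimage measurable_fst).inter (measurableSet_Iio.preimage measurable_snd)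

lemma measurable_gridPerm (K : ℕ) [NeZero K] (σ : Equiv.Perm (Fin K × Fin K)) :
    Measurable (gridPerm K σ) := by
  refine Measurable.ite measurableSet_interior_square ?_ measurable_id
  have hc := measurable_gridCell K
  have key : ∀ (a : USq → ℝ) (x : USq → UI), Measurable a → Measurable x →
      Measurable fun u => Set.projIcc (0 : ℝ) 1 zero_le_one ((x u : ℝ) + a u) :=
    fun a x ha hx => continuous_projIcc.measurable.comp ((measurable_subtype_coe.comp hx).add ha)
  have hd : ∀ F : Fin K × Fin K → ℝ, Measurable fun u => F (gridCell K u) := fun F =>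
    (Measurable.of_discrete (f := F)).comp hc
  exact (key _ _ (hd fun c => (((σ c).1 : ℕ) - (c.1 : ℕ) : ℝ) / K) measurable_fst).prodMk
    (key _ _ (hd fun c => (((σ c).2 : ℕ) - (c.2 : ℕ) : ℝ) / K) measurable_snd)

lemma volume_image_coe_square (A : Set USq) :
    volume (Prod.map ((↑) : UI → ℝ) ((↑) : UI → ℝ) '' A) = volume A := by
  have hI : MeasurableSet (Set.Icc (0 : ℝ) 1) := measurableSet_Icc
  have h1 : MeasurePreserving ((↑) : UI → ℝ) volume (volume.restrict (Set.Icc 0 1)) :=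
    measurePreserving_subtype_coe hI
  have h2 : MeasurePreserving (Prod.map ((↑) : UI → ℝ) ((↑) : UI → ℝ)) (volume : Measure USq)
      ((volume.restrict (Set.Icc 0 1)).prod (volume.restrict (Set.Icc 0 1))) := h1.prod h1
  have he : MeasurableEmbedding (Prod.map ((↑) : UI → ℝ) ((↑) : UI → ℝ)) :=
    (MeasurableEmbedding.subtype_coe hI).prodMap (MeasurableEmbedding.subtype_coe hI)
  have h3 := h2.measure_preimage_emb he (Prod.map ((↑) : UI → ℝ) ((↑) : UI → ℝ) '' A)
  rw [Set.preimage_image_eq _ he.injective, Measure.prod_restrict,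
    Measure.restrict_eq_self] at h3
  · exact h3.symm
  · rintro _ ⟨u, -, rfl⟩
    exact ⟨u.1.2, u.2.2⟩

lemma volume_interior_square_compl : volume {u : USq | u.1 < 1 ∧ u.2 < 1}ᶜ = 0 := by
  refine measure_mono_null (t := ({1} ×ˢ Set.univ) ∪ (Set.univ ×ˢ {1})) (fun u hu => ?_)
    (measure_union_null ?_ ?_)
  · simp only [Set.mem_compl_iff, Set.mem_ofPred_eq, not_and_or, not_lt] at hu
    exact hu.imp (fun h => ⟨le_antisymm u.1.2.2 h, trivial⟩)
      (fun h => ⟨trivial, le_antisymm u.2.2.2 h⟩)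
  · rw [Measure.volume_eq_prod, Measure.prod_prod]; simp
  · rw [Measure.volume_eq_prod, Measure.prod_prod]; simp

lemma measurePreserving_gridPerm (K : ℕ) [NeZero K] (σ : Equiv.Perm (Fin K × Fin K)) :
    MeasurePreserving (gridPerm K σ) volume volume := by
  set I : Set USq := {u | u.1 < 1 ∧ u.2 < 1} with hI
  have hm := measurable_gridPerm K σ
  refine ⟨hm, ?_⟩
  have := Measure.isProbabilityMeasure_map (μ := (volume : Measure USq)) hm.aemeasurable
  refine Measure.eq_of_le_of_isProbabilityMeasure (Measure.le_iff.2 fun A hA => ?_)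
  rw [Measure.map_apply hm hA]
  have hcell : ∀ c, volume (gridPerm K σ ⁻¹' A ∩ (I ∩ gridCell K ⁻¹' {c})) ≤
      volume (A ∩ gridCell K ⁻¹' {σ c}) := fun c => by
    let v : ℝ × ℝ := ((((σ c).1 : ℕ) - (c.1 : ℕ) : ℝ) / K, (((σ c).2 : ℕ) - (c.2 : ℕ) : ℝ) / K)
    rw [← volume_image_coe_square, ← volume_image_coe_square (A ∩ _),
      ← measure_preimage_add_right volume v (Prod.map _ _ '' (A ∩ _))]
    refine measure_mono ?_
    rintro _ ⟨u, ⟨huA, huI, rfl⟩, rfl⟩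
    refine ⟨gridPerm K σ u, ⟨huA, (gridCell_gridPerm K σ huI).2⟩, ?_⟩
    exact Prod.ext (coe_gridPerm K σ huI).1 (coe_gridPerm K σ huI).2
  calc volume (gridPerm K σ ⁻¹' A)
      ≤ volume (Iᶜ ∪ ⋃ c, gridPerm K σ ⁻¹' A ∩ (I ∩ gridCell K ⁻¹' {c})) :=
        measure_mono fun u hu => by
          by_cases h : u ∈ I
          · exact Or.inr (Set.mem_iUnion.2 ⟨gridCell K u, hu, h, rfl⟩)
          · exact Or.inl h
    _ ≤ volume Iᶜ + ∑ c, volume (gridPerm K σ ⁻¹' A ∩ (I ∩ gridCell K ⁻¹' {c})) :=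
        (measure_union_le _ _).trans (by gcongr; exact measure_iUnion_fintype_le _ _)
    _ ≤ 0 + ∑ c, volume (A ∩ gridCell K ⁻¹' {σ c}) := by
        rw [volume_interior_square_compl]
        exact add_le_add le_rfl (Finset.sum_le_sum fun c _ => hcell c)
    _ = ∑ c, volume (A ∩ gridCell K ⁻¹' {c}) := by
        rw [zero_add]
        exact Equiv.sum_comp σ fun c => volume (A ∩ gridCell K ⁻¹' {c})
    _ = volume A := by
        rw [← measure_biUnion_finset]
        · congr 1
          ext u
          simp
        · intro c _ d _ hcd
          exact Set.disjoint_left.2 fun u hu hv => hcd (hu.2.symm.trans hv.2)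
        · exact fun c _ => hA.inter (measurable_gridCell K (measurableSet_singleton c))

lemma isMPB_gridPerm (K : ℕ) [NeZero K] (σ : Equiv.Perm (Fin K × Fin K)) :
    IsMPB (gridPerm K σ) :=
  ⟨measurePreserving_gridPerm K σ, gridPerm K σ.symm, measurePreserving_gridPerm K _,
    gridPerm_leftInverse K σ.symm_apply_apply, gridPerm_leftInverse K σ.apply_symm_apply⟩

lemma volume_gridCell_preimage (K : ℕ) [NeZero K] :
    ∃ w : ℝ, 0 ≤ w ∧ ∀ F : Finset (Fin K × Fin K),
      volume.real (gridCell K ⁻¹' (F : Set (Fin K × Fin K))) = F.card * w := by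
  have hK : 0 < K := NeZero.pos K
  let c₀ : Fin K × Fin K := (⟨0, hK⟩, ⟨0, hK⟩)
  have hmeas : ∀ c, MeasurableSet (gridCell K ⁻¹' {c}) := fun c =>
    measurable_gridCell K (measurableSet_singleton c)
  have heq : ∀ c, volume.real (gridCell K ⁻¹' {c}) = volume.real (gridCell K ⁻¹' {c₀}) := by
    intro c
    rw [← (measurePreserving_gridPerm K (Equiv.swap c c₀)).measureReal_preimage
      (hmeas c₀).nullMeasurableSet]
    refine measureReal_congr ?_
    have hae : ∀ᵐ u : USq, u.1 < 1 ∧ u.2 < 1 := volume_interior_square_compl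
    filter_upwards [hae] with u hu
    have := (gridCell_gridPerm K (Equiv.swap c c₀) hu).2
    refine propext ?_
    change gridCell K u = c ↔ gridCell K (gridPerm K (Equiv.swap c c₀) u) = c₀
    rw [this, Equiv.swap_apply_eq_iff, Equiv.swap_apply_right]
  refine ⟨volume.real (gridCell K ⁻¹' {c₀}), measureReal_nonneg, fun F => ?_⟩
  have : gridCell K ⁻¹' (F : Set (Fin K × Fin K)) = ⋃ c ∈ F, gridCell K ⁻¹' {c} := by
    ext u; simp
  rw [this, measureReal_biUnion_finset _ fun c _ => hmeas c]
  · simp [heq]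
  · intro c _ d _ hcd
    exact Set.disjoint_left.2 fun u hu hv => hcd (hu.symm.trans hv)
/-- A permutation of a finite set, preserving a given partition, which matches two labellings as
well as the sizes of their classes allow. -/
lemma exists_perm_card_ne_le {J N L : Type*} [Fintype J] [Fintype N] [DecidableEq N]
    [Fintype L] (a b : J → L) (s : J → N) :
    ∃ σ : Equiv.Perm J, (∀ j, s (σ j) = s j) ∧
      ((Finset.univ.filter fun j => b (σ j) ≠ a j).card : ℝ) ≤
        ∑ i, ∑ q, |((Finset.univ.filter fun j => s j = i ∧ a j = q).card : ℝ) -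
          (Finset.univ.filter fun j => s j = i ∧ b j = q).card| := by
  let Z : Equiv.Perm J → Finset J := fun σ => Finset.univ.filter fun j => b (σ j) ≠ a j
  have hZ : ∀ σ j, j ∈ Z σ ↔ b (σ j) ≠ a j := fun σ j => by simp [Z]
  obtain ⟨σ, hσ, hmin⟩ := Finset.exists_min_image
    (Finset.univ.filter fun σ : Equiv.Perm J => ∀ j, s (σ j) = s j) (fun σ => (Z σ).card)
    ⟨1, by simp⟩
  simp only [Finset.mem_filter, Finset.mem_univ, true_and] at hσ hmin
  refine ⟨σ, hσ, ?_⟩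
  have hno : ∀ j k, s j = s k → b (σ k) ≠ a k → b (σ j) ≠ a j → b (σ k) ≠ a j := by
    intro j k hs hk hj he
    have hjk : j ≠ k := by rintro rfl; exact hj he
    have := hmin (σ * Equiv.swap j k) fun l => by
      rw [Equiv.Perm.mul_apply, hσ]
      rcases eq_or_ne l j with rfl | h1
      · rw [Equiv.swap_apply_left, hs]
      rcases eq_or_ne l k with rfl | h2
      · rw [Equiv.swap_apply_right, hs]
      rw [Equiv.swap_apply_of_ne_of_ne h1 h2]
    refine absurd this (not_le.2 (Finset.card_lt_card (Finset.ssubset_iff_of_subset ?_ |>.2 ?_)))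
    · intro l
      rw [hZ, hZ, Equiv.Perm.mul_apply]
      rcases eq_or_ne l j with rfl | h1
      · exact fun _ => hj
      rcases eq_or_ne l k with rfl | h2
      · exact fun _ => hk
      rw [Equiv.swap_apply_of_ne_of_ne h1 h2]
      exact id
    · exact ⟨j, (hZ _ _).2 hj, by simpa [hZ] using he⟩
  have hclass : ∀ i q, ((Z σ).filter fun j => s j = i ∧ a j = q).card ≤
      |((Finset.univ.filter fun j => s j = i ∧ a j = q).card : ℤ) -
          (Finset.univ.filter fun j => s j = i ∧ b j = q).card| := by
    intro i q
    by_cases hne : ((Z σ).filter fun j => s j = i ∧ a j = q).Nonempty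
    · obtain ⟨j, hj⟩ := hne
      simp only [Z, Finset.mem_filter, Finset.mem_univ, true_and] at hj
      have h1 : (Finset.univ.filter fun j => s j = i ∧ b j = q).card =
          (Finset.univ.filter fun j => s j = i ∧ b (σ j) = q).card := by
        refine (Finset.card_bij (fun j _ => σ j) ?_ (fun _ _ _ _ h => σ.injective h) ?_).symm
        · intro k; simp [hσ]
        · intro k hk
          refine ⟨σ.symm k, ?_, by simp⟩
          have := hσ (σ.symm k)
          simp_all
      have h2 : (Finset.univ.filter fun j => s j = i ∧ b (σ j) = q) ⊆
          (Finset.univ.filter fun j => s j = i ∧ a j = q) \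
            ((Z σ).filter fun j => s j = i ∧ a j = q) := by
        intro k hk
        simp only [Z, Finset.mem_filter, Finset.mem_univ, true_and, Finset.mem_sdiff] at hk ⊢
        have : a k = q := by
          by_contra h
          exact hno j k (hj.2.1.trans hk.1.symm) (by rw [hk.2]; exact Ne.symm h) hj.1
            (hk.2.trans hj.2.2.symm)
        refine ⟨⟨hk.1, this⟩, fun h => h.1 (hk.2.trans this.symm)⟩
      have h3 := Finset.card_le_card h2
      have h4 : ((Z σ).filter fun j => s j = i ∧ a j = q) ⊆
          Finset.univ.filter fun j => s j = i ∧ a j = q :=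
        Finset.filter_subset_filter _ (Finset.subset_univ _)
      rw [Finset.card_sdiff_of_subset h4] at h3
      have h5 := Finset.card_le_card h4
      rw [h1]
      refine le_trans ?_ (le_abs_self _)
      omega
    · rw [Finset.not_nonempty_iff_eq_empty.1 hne]
      simp
  have hsum : ((Z σ).card : ℤ) =
      ∑ i, ∑ q, (((Z σ).filter fun j => s j = i ∧ a j = q).card : ℤ) := by
    rw [← Fintype.sum_prod_type' (f := fun i q =>
      (((Z σ).filter fun j => s j = i ∧ a j = q).card : ℤ)),
      Finset.card_eq_sum_card_fiberwise (t := Finset.univ) (f := fun j => (s j, a j))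
      (by simp)]
    simp [Prod.ext_iff]
  have hle : ((Z σ).card : ℤ) ≤ _ := hsum.le.trans <|
    Finset.sum_le_sum fun i _ => Finset.sum_le_sum fun q _ => hclass i q
  exact_mod_cast hle
lemma dist_lt_of_gridCell_eq {K : ℕ} [NeZero K] {u v : USq} (hu : u.1 < 1 ∧ u.2 < 1)
    (hv : v.1 < 1 ∧ v.2 < 1) (h : gridCell K u = gridCell K v) : dist u v < 1 / K := by
  have hK : (0 : ℝ) < K := Nat.cast_pos.2 (NeZero.pos K)
  have key : ∀ x y : UI, x < 1 → y < 1 →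
      Fin.ofNat K ⌊K * (x : ℝ)⌋₊ = Fin.ofNat K ⌊K * (y : ℝ)⌋₊ → dist x y < 1 / K := by
    intro x y hx hy hxy
    have e := congrArg Fin.val hxy
    rw [Fin.val_ofNat, Fin.val_ofNat, Nat.mod_eq_of_lt (floor_lt_of_lt_one K hx),
      Nat.mod_eq_of_lt (floor_lt_of_lt_one K hy)] at e
    have h1 := Nat.floor_le (mul_nonneg hK.le x.2.1)
    have h2 := Nat.lt_floor_add_one (K * (x : ℝ))
    have h3 := Nat.floor_le (mul_nonneg hK.le y.2.1)
    have h4 := Nat.lt_floor_add_one (K * (y : ℝ))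
    rw [e] at h1 h2
    have h5 : |K * ((x : ℝ) - y)| < 1 := by
      rw [abs_lt]
      constructor <;> linarith
    rwa [Subtype.dist_eq, Real.dist_eq, lt_div_iff₀ hK, mul_comm, ← abs_of_pos hK, ← abs_mul]
  exact max_lt (key _ _ hu.1 hv.1 (congrArg Prod.fst h)) (key _ _ hu.2 hv.2 (congrArg Prod.snd h))

/-- A finite labelling of the square is approximately constant on the cells of fine grids. -/
lemma exists_gridCell_approx {L : Type*} [Fintype L] [MeasurableSpace L]
    [MeasurableSingletonClass L] {a : USq → L} (ha : Measurable a) {δ : ℝ} (hδ : 0 < δ) :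
    ∃ K₀ : ℕ, ∀ (K : ℕ) [NeZero K], K₀ ≤ K →
      ∃ a' : Fin K × Fin K → L, volume.real {u | a u ≠ a' (gridCell K u)} ≤ δ := by
  let e := Fintype.equivFin L
  have hgm : Measurable fun u => ((e (a u) : ℕ) : ℝ) :=
    (Measurable.of_discrete (f := fun l => ((e l : ℕ) : ℝ))).comp ha
  have hgi : Integrable (fun u => ((e (a u) : ℕ) : ℝ)) volume :=
    integrable_of_measurable_of_abs_le (C := Fintype.card L) hgm fun u => by
      rw [abs_of_nonneg (Nat.cast_nonneg _)]
      exact_mod_cast (e (a u)).2.le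
  obtain ⟨h, hh, hhi⟩ := hgi.exists_boundedContinuous_integral_sub_le
    (show (0 : ℝ) < δ / 4 by positivity)
  set B : Set USq := {u | 1 / 4 ≤ |((e (a u) : ℕ) : ℝ) - h u|} with hB
  have hBδ : volume.real B ≤ δ := by
    have := mul_meas_ge_le_integral_of_nonneg (μ := (volume : Measure USq))
      (f := fun u => ‖((e (a u) : ℕ) : ℝ) - h u‖) (ae_of_all _ fun u => norm_nonneg _)
      (hgi.sub hhi).norm (1 / 4)
    simp only [Real.norm_eq_abs] at this hh
    change 1 / 4 * volume.real B ≤ _ at this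
    linarith
  obtain ⟨η, hη, huc⟩ := Metric.uniformContinuous_iff.1
    (CompactSpace.uniformContinuous_of_continuous h.continuous) (1 / 2) (by norm_num)
  obtain ⟨K₀, hK₀⟩ := exists_nat_gt (1 / η)
  refine ⟨K₀, fun K _ hK => ?_⟩
  have hK' : (0 : ℝ) < K := Nat.cast_pos.2 (NeZero.pos K)
  have hKη : 1 / (K : ℝ) < η := by
    rw [div_lt_comm₀ hK' hη]
    exact hK₀.trans_le (by exact_mod_cast hK)
  have hL : Nonempty L := ⟨a (0, 0)⟩
  have hex : ∀ c, ∃ l, ∀ u, gridCell K u = c → (u.1 < 1 ∧ u.2 < 1) → u ∉ B → a u = l := by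
    intro c
    by_cases hc : ∃ v, gridCell K v = c ∧ (v.1 < 1 ∧ v.2 < 1) ∧ v ∉ B
    · obtain ⟨v, rfl, hv, hvB⟩ := hc
      refine ⟨a v, fun u huv hu huB => e.injective (Fin.ext ?_)⟩
      have h1 := huc ((dist_lt_of_gridCell_eq hu hv huv).trans hKη)
      simp only [hB, Set.mem_ofPred_eq, not_le] at huB hvB
      rw [Real.dist_eq] at h1
      rw [abs_lt] at h1 huB hvB
      have h2 : ((e (a u) : ℕ) : ℝ) < (e (a v) : ℕ) + 1 := by linarith
      have h3 : ((e (a v) : ℕ) : ℝ) < (e (a u) : ℕ) + 1 := by linarith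
      have h4 : (e (a u) : ℕ) < (e (a v) : ℕ) + 1 := by exact_mod_cast h2
      have h5 : (e (a v) : ℕ) < (e (a u) : ℕ) + 1 := by exact_mod_cast h3
      omega
    · exact ⟨Classical.choice hL, fun u h1 h2 h3 => absurd ⟨u, h1, h2, h3⟩ hc⟩
  choose a' ha' using hex
  refine ⟨a', le_trans ?_ hBδ⟩
  have hae : ∀ᵐ u : USq, u.1 < 1 ∧ u.2 < 1 := volume_interior_square_compl
  refine ENNReal.toReal_mono (measure_ne_top _ _) (measure_mono_ae ?_)
  filter_upwards [hae] with u hu h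
  by_contra hn
  exact h (ha' _ u rfl hu hn)

lemma abs_measureReal_inter_sub_le {Ω L : Type*} [MeasurableSpace Ω] (P : Measure Ω)
    [IsFiniteMeasure P] (a b : Ω → L) (S : Set Ω) (q : L) :
    |P.real (S ∩ a ⁻¹' {q}) - P.real (S ∩ b ⁻¹' {q})| ≤ P.real {u | a u ≠ b u} := by
  have key : ∀ a b : Ω → L, P.real (S ∩ a ⁻¹' {q}) ≤
      P.real (S ∩ b ⁻¹' {q}) + P.real {u | a u ≠ b u} := fun a b => by
    refine (measureReal_mono ?_).trans (measureReal_union_le _ _)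
    rintro u ⟨hS, hu⟩
    by_cases h : a u = b u
    · exact Or.inl ⟨hS, h.symm.trans hu⟩
    · exact Or.inr h
  have h1 := key a b
  have h2 := key b a
  simp only [ne_comm (a := b _)] at h2
  rw [abs_le]
  constructor <;> linarith

/-- Two finite labellings of the square are matched by a measure-preserving bijection with small
shift, as well as the measures of their classes within vertical strips allow. -/
lemma exists_isMPB_measureReal_ne_le {L : Type*} [Fintype L] [MeasurableSpace L]
    [MeasurableSingletonClass L] {a b : USq → L} (ha : Measurable a) (hb : Measurable b)
    (N : ℕ) [NeZero N] {δ : ℝ} (hδ : 0 < δ) :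
    ∃ f, IsMPB f ∧ shiftOf f ≤ 1 / N ∧ volume.real {u | b (f u) ≠ a u} ≤
      ∑ i, ∑ q, |volume.real ({u | (gridCell N u).1 = i} ∩ a ⁻¹' {q}) -
        volume.real ({u | (gridCell N u).1 = i} ∩ b ⁻¹' {q})| + δ := by
  have hN : 0 < N := NeZero.pos N
  set δ' := δ / (2 + 2 * (N * Fintype.card L : ℝ)) with hδ'
  have hδ'0 : 0 < δ' := by positivity
  obtain ⟨K₁, hK₁⟩ := exists_gridCell_approx ha hδ'0
  obtain ⟨K₂, hK₂⟩ := exists_gridCell_approx hb hδ'0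
  obtain ⟨M, hM⟩ : ∃ M, M = K₁ + K₂ + 1 := ⟨_, rfl⟩
  obtain ⟨K, hKdef⟩ : ∃ K, K = N * M := ⟨_, rfl⟩
  have hM0 : 0 < M := by omega
  have hMK : M ≤ K := hKdef ▸ Nat.le_mul_of_pos_left _ hN
  have : NeZero K := ⟨hKdef ▸ (Nat.mul_pos hN hM0).ne'⟩
  obtain ⟨a', ha'⟩ := hK₁ K (by omega)
  obtain ⟨b', hb'⟩ := hK₂ K (by omega)
  let s : Fin K × Fin K → Fin N := fun c => ⟨c.1 / M, Nat.div_lt_of_lt_mul (by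
    rw [mul_comm, ← hKdef]; exact c.1.2)⟩
  have hs : ∀ u, s (gridCell K u) = (gridCell N u).1 := fun u => by
    refine Fin.ext ?_
    simp only [s, gridCell, Fin.val_ofNat]
    rw [hKdef, Nat.mod_mul_left_div_self, ← Nat.floor_div_natCast, Nat.cast_mul, mul_right_comm,
      mul_div_cancel_right₀ _ (Nat.cast_ne_zero.2 hM0.ne')]
  obtain ⟨σ, hσ, hcard⟩ := exists_perm_card_ne_le a' b' s
  have hf := isMPB_gridPerm K σ
  refine ⟨gridPerm K σ, hf, ciSup_le fun u => ?_, ?_⟩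
  · by_cases hu : u.1 < 1 ∧ u.2 < 1
    · have h := congrArg Fin.val (hσ (gridCell K u))
      have h1 := Nat.div_add_mod (σ (gridCell K u)).1 M
      have h2 := Nat.div_add_mod (gridCell K u).1 M
      have h3 := Nat.mod_lt (σ (gridCell K u)).1 hM0
      have h4 := Nat.mod_lt (gridCell K u).1 hM0
      simp only [s] at h
      rw [h] at h1
      have h5 : ((σ (gridCell K u)).1 : ℕ) < (gridCell K u).1 + M := by omega
      have h6 : ((gridCell K u).1 : ℕ) < (σ (gridCell K u)).1 + M := by omega
      have h7 : (((σ (gridCell K u)).1 : ℕ) : ℝ) ≤ ((gridCell K u).1 : ℕ) + M := by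
        exact_mod_cast h5.le
      have h8 : (((gridCell K u).1 : ℕ) : ℝ) ≤ ((σ (gridCell K u)).1 : ℕ) + M := by
        exact_mod_cast h6.le
      have hM' : (0 : ℝ) < M := Nat.cast_pos.2 hM0
      have hN' : (0 : ℝ) < N := Nat.cast_pos.2 hN
      rw [(coe_gridPerm K σ hu).1, sub_add_cancel_left, abs_neg, abs_div, Nat.abs_cast,
        show (1 : ℝ) / N = M / K by rw [hKdef]; push_cast; field_simp]
      gcongr
      rw [abs_le]
      constructor <;> linarith
    · rw [show gridPerm K σ u = u from if_neg hu]
      simp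
  obtain ⟨w, hw0, hw⟩ := volume_gridCell_preimage K
  have hae : ∀ᵐ u : USq, u.1 < 1 ∧ u.2 < 1 := volume_interior_square_compl
  have hcell : ∀ (d : Fin K × Fin K → L) i q,
      ((Finset.univ.filter fun j => s j = i ∧ d j = q).card : ℝ) * w =
        volume.real ({u | (gridCell N u).1 = i} ∩ (fun u => d (gridCell K u)) ⁻¹' {q}) := by
    intro d i q
    rw [← hw]
    congr 1
    ext u
    simp [hs]
  have hmid : volume.real {u | b' (gridCell K (gridPerm K σ u)) ≠ a' (gridCell K u)} ≤
      ∑ i, ∑ q, |volume.real ({u | (gridCell N u).1 = i} ∩ a ⁻¹' {q}) -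
        volume.real ({u | (gridCell N u).1 = i} ∩ b ⁻¹' {q})| +
          2 * (N * Fintype.card L : ℝ) * δ' := by
    calc _ = volume.real (gridCell K ⁻¹'
          ((Finset.univ.filter fun j => b' (σ j) ≠ a' j : Finset _) : Set (Fin K × Fin K))) := by
          refine measureReal_congr ?_
          filter_upwards [hae] with u hu
          refine propext ?_
          change b' (gridCell K (gridPerm K σ u)) ≠ a' (gridCell K u) ↔ gridCell K u ∈
            ((Finset.univ.filter fun j => b' (σ j) ≠ a' j : Finset _) : Set (Fin K × Fin K))
          rw [(gridCell_gridPerm K σ hu).2]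
          simp
      _ = (Finset.univ.filter fun j => b' (σ j) ≠ a' j).card * w := hw _
      _ ≤ (∑ i, ∑ q, |((Finset.univ.filter fun j => s j = i ∧ a' j = q).card : ℝ) -
          (Finset.univ.filter fun j => s j = i ∧ b' j = q).card|) * w := by
          gcongr
      _ = ∑ i, ∑ q, |volume.real ({u | (gridCell N u).1 = i} ∩
            (fun u => a' (gridCell K u)) ⁻¹' {q}) - volume.real ({u | (gridCell N u).1 = i} ∩
            (fun u => b' (gridCell K u)) ⁻¹' {q})| := by
          simp only [Finset.sum_mul, ← hcell, ← sub_mul, abs_mul, abs_of_nonneg hw0]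
      _ ≤ ∑ i : Fin N, ∑ q : L, (|volume.real ({u | (gridCell N u).1 = i} ∩ a ⁻¹' {q}) -
            volume.real ({u | (gridCell N u).1 = i} ∩ b ⁻¹' {q})| + 2 * δ') := by
          gcongr with i _ q _
          have h1 := (abs_measureReal_inter_sub_le volume a (fun u => a' (gridCell K u))
            {u | (gridCell N u).1 = i} q).trans ha'
          have h2 := (abs_measureReal_inter_sub_le volume b (fun u => b' (gridCell K u))
            {u | (gridCell N u).1 = i} q).trans hb'
          rw [abs_sub_comm] at h1
          have h3 := abs_add_three
            (volume.real ({u | (gridCell N u).1 = i} ∩ (fun u => a' (gridCell K u)) ⁻¹' {q}) -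
              volume.real ({u | (gridCell N u).1 = i} ∩ a ⁻¹' {q}))
            (volume.real ({u | (gridCell N u).1 = i} ∩ a ⁻¹' {q}) -
              volume.real ({u | (gridCell N u).1 = i} ∩ b ⁻¹' {q}))
            (volume.real ({u | (gridCell N u).1 = i} ∩ b ⁻¹' {q}) -
              volume.real ({u | (gridCell N u).1 = i} ∩ (fun u => b' (gridCell K u)) ⁻¹' {q}))
          rw [sub_add_sub_cancel, sub_add_sub_cancel] at h3
          linarith
      _ = _ := by
          simp only [Finset.sum_add_distrib, Finset.sum_const, Finset.card_univ, Fintype.card_fin,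
            nsmul_eq_mul]
          ring
  have hb'' : volume.real (gridPerm K σ ⁻¹' {u | b u ≠ b' (gridCell K u)}) ≤ δ' := by
    rw [hf.1.measureReal_preimage]
    · exact hb'
    · have hm := hb.prodMk ((Measurable.of_discrete (f := b')).comp (measurable_gridCell K))
      exact (hm (MeasurableSet.of_discrete (s := {p : L × L | p.1 ≠ p.2}))).nullMeasurableSet
  have hsub : {u | b (gridPerm K σ u) ≠ a u} ⊆
      ({u | a u ≠ a' (gridCell K u)} ∪ gridPerm K σ ⁻¹' {u | b u ≠ b' (gridCell K u)}) ∪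
        {u | b' (gridCell K (gridPerm K σ u)) ≠ a' (gridCell K u)} := by
    intro u hu
    by_contra hn
    simp only [Set.mem_union, Set.mem_preimage, Set.mem_ofPred_eq, not_or, not_not] at hn hu
    exact hu (hn.1.2.trans (hn.2.trans hn.1.1.symm))
  have h1 := (measureReal_mono (μ := (volume : Measure USq)) hsub).trans
    (measureReal_union_le _ _)
  have h2 := measureReal_union_le (μ := (volume : Measure USq)) {u | a u ≠ a' (gridCell K u)}
    (gridPerm K σ ⁻¹' {u | b u ≠ b' (gridCell K u)})
  have h3 : (2 + 2 * (N * Fintype.card L : ℝ)) * δ' = δ := by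
    rw [hδ']; field_simp
  linarith

/-- A law on `[0,1] × Y` with uniform first marginal is the law of a map on the square that
preserves the first coordinate. -/
lemma exists_measurable_map_eq_of_fst_eq {Y : Type*} [MeasurableSpace Y] [StandardBorelSpace Y]
    [Nonempty Y] (ν : Measure (UI × Y)) [IsProbabilityMeasure ν] (hν : ν.fst = volume) :
    ∃ Ψ : USq → UI × Y, Measurable Ψ ∧ (∀ u, (Ψ u).1 = u.1) ∧
      (volume : Measure USq).map Ψ = ν := by
  obtain ⟨r, hr, hmap⟩ :=
    ProbabilityTheory.Kernel.exists_measurable_map_eq_unitInterval ν.condKernel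
  have hΨ : Measurable fun u : USq => (u.1, r u.1 u.2) := measurable_fst.prodMk hr
  refine ⟨_, hΨ, fun u => rfl, Measure.ext fun A hA => ?_⟩
  rw [Measure.map_apply hΨ hA, Measure.volume_eq_prod, Measure.prod_apply (hΨ hA)]
  conv_rhs => rw [← ν.disintegrate ν.condKernel]
  rw [Measure.compProd_apply hA, hν]
  refine lintegral_congr fun x => ?_
  have hrx : Measurable (r x) := hr.comp measurable_prodMk_left
  rw [← hmap x, Measure.map_apply hrx (measurable_prodMk_left hA)]
  rfl

lemma countable_frontier_strip (N : ℕ) [NeZero N] (i : Fin N) :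
    (frontier {x : UI | Fin.ofNat N ⌊N * (x : ℝ)⌋₊ = i}).Countable := by
  have hN : (0 : ℝ) < N := Nat.cast_pos.2 (NeZero.pos N)
  have hsub : frontier {x : UI | Fin.ofNat N ⌊N * (x : ℝ)⌋₊ = i} ⊆
      ((↑) : UI → ℝ) ⁻¹' Set.range fun j : ℕ => (j : ℝ) / N := by
    intro x hx
    by_contra hn
    have h0 : 0 ≤ N * (x : ℝ) := mul_nonneg hN.le x.2.1
    have h1 : (⌊N * (x : ℝ)⌋₊ : ℝ) < N * x := (Nat.floor_le h0).lt_of_ne fun h =>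
      hn ⟨⌊N * (x : ℝ)⌋₊, by simp only [h]; field_simp⟩
    have h2 := Nat.lt_floor_add_one (N * (x : ℝ))
    have hc : Continuous fun y : UI => N * (y : ℝ) := by fun_prop
    have hev : ∀ᶠ y : UI in nhds x, ⌊N * (y : ℝ)⌋₊ = ⌊N * (x : ℝ)⌋₊ := by
      filter_upwards [hc.continuousAt.eventually (lt_mem_nhds h1),
        hc.continuousAt.eventually (gt_mem_nhds h2)] with y hy1 hy2
      exact (Nat.floor_eq_iff (mul_nonneg hN.le y.2.1)).2 ⟨hy1.le, hy2⟩
    rw [frontier_eq_closure_inter_closure] at hx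
    by_cases hi : Fin.ofNat N ⌊N * (x : ℝ)⌋₊ = i
    · obtain ⟨y, hy, hy'⟩ := (mem_closure_iff_frequently.1 hx.2).and_eventually hev |>.exists
      exact hy (by rw [← hi, ← hy']; rfl)
    · obtain ⟨y, hy, hy'⟩ := (mem_closure_iff_frequently.1 hx.1).and_eventually hev |>.exists
      rw [Set.mem_ofPred_eq, hy'] at hy
      exact hi hy
  exact ((Set.countable_range _).preimage Subtype.val_injective).mono hsub

lemma tendsto_measureReal_strip_prod {Y : Type*} [TopologicalSpace Y] [MeasurableSpace Y]
    [OpensMeasurableSpace (UI × Y)] [HasOuterApproxClosed (UI × Y)]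
    {μs : ℕ → ProbabilityMeasure (UI × Y)} {μ : ProbabilityMeasure (UI × Y)}
    (h : Tendsto μs atTop (nhds μ)) (hμ : (μ : Measure (UI × Y)).fst = volume)
    (N : ℕ) [NeZero N] (i : Fin N) {C : Set Y} (hC : IsClopen C) :
    Tendsto (fun n => (μs n : Measure (UI × Y)).real
      ({x : UI | Fin.ofNat N ⌊N * (x : ℝ)⌋₊ = i} ×ˢ C)) atTop
      (nhds ((μ : Measure (UI × Y)).real ({x : UI | Fin.ofNat N ⌊N * (x : ℝ)⌋₊ = i} ×ˢ C))) := by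
  refine (ENNReal.tendsto_toReal (measure_ne_top _ _)).comp
    (ProbabilityMeasure.tendsto_measure_of_null_frontier_of_tendsto' h ?_)
  have hc := countable_frontier_strip N i
  rw [frontier_prod_eq, hC.frontier_eq, Set.prod_empty, Set.empty_union]
  refine measure_mono_null (t := Prod.fst ⁻¹' frontier _) (fun p hp => hp.1) ?_
  rw [← Measure.fst_apply hc.measurableSet, hμ]
  exact hc.measure_zero _

lemma shiftOf_nonneg (f : USq → USq) : 0 ≤ shiftOf f := Real.iSup_nonneg fun _ => abs_nonneg _

lemma cutNorm_nonneg (W : USq → USq → ℝ) : 0 ≤ cutNorm W := by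
  refine Real.sSup_nonneg ?_
  rintro _ ⟨S, T, -, -, rfl⟩
  exact abs_nonneg _

lemma csDist_nonneg (W U : USq → USq → ℝ) : 0 ≤ csDist W U := by
  refine Real.sInf_nonneg ?_
  rintro _ ⟨f, -, rfl⟩
  exact add_nonneg (shiftOf_nonneg f) (cutNorm_nonneg _)

lemma csDist_le {W U : USq → USq → ℝ} {f : USq → USq} (hf : IsMPB f) {s r : ℝ}
    (hs : shiftOf f ≤ s) (hr : ∀ S T : Set USq, MeasurableSet S → MeasurableSet T →
      |∫ p in S ×ˢ T, (W p.1 p.2 - U (f p.1) (f p.2))| ≤ r) : csDist W U ≤ s + r := by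
  have hcut : cutNorm (fun u v => W u v - U (f u) (f v)) ≤ r := by
    refine csSup_le ⟨_, ∅, ∅, .empty, .empty, rfl⟩ ?_
    rintro _ ⟨S, T, hS, hT, rfl⟩
    exact hr S T hS hT
  refine le_trans (csInf_le ⟨0, ?_⟩ ⟨f, hf, rfl⟩) (add_le_add hs hcut)
  rintro _ ⟨f, -, rfl⟩
  exact add_nonneg (shiftOf_nonneg f) (cutNorm_nonneg _)

lemma abs_setIntegral_finRankKernel_sub_le_add {Ω : Type*} [MeasurableSpace Ω] (P : Measure Ω)
    [IsProbabilityMeasure P] {m : ℕ} {c a : ℕ → ℝ} (hc : ∀ i, |c i| ≤ 1) (ha : ∀ i, |a i| ≤ 1)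
    {E E' : ℕ → Bool → Ω → ℝ} (hE : ∀ i b x, E i b x ∈ Set.Icc (0 : ℝ) 1)
    (hE' : ∀ i b x, E' i b x ∈ Set.Icc (0 : ℝ) 1) {D : Set Ω} (hD : MeasurableSet D)
    (hEE' : ∀ u ∉ D, ∀ i < m, ∀ b, E i b u = E' i b u) (A : Set (Ω × Ω)) :
    |∫ p in A, (finRankKernel m c E p - finRankKernel m a E' p) ∂(P.prod P)| ≤
      ∑ i ∈ Finset.range m, |c i - a i| + 4 * m * P.real D := by
  set r := ∑ i ∈ Finset.range m, |c i - a i| with hr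
  have hr0 : 0 ≤ r := Finset.sum_nonneg fun i _ => abs_nonneg _
  set G : Ω × Ω → ℝ := fun p => r + 2 * m * (D.indicator 1 p.1 + D.indicator 1 p.2) with hG
  have h01 : ∀ u, (0 : ℝ) ≤ D.indicator 1 u := fun u =>
    Set.indicator_nonneg (fun _ _ => zero_le_one) u
  have hi : Integrable (D.indicator (1 : Ω → ℝ)) P := (integrable_const 1).indicator hD
  have hs : Integrable (fun p : Ω × Ω => D.indicator (1 : Ω → ℝ) p.1 + D.indicator 1 p.2)
      (P.prod P) := (hi.comp_fst P).add (hi.comp_snd P)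
  have hGi : Integrable G (P.prod P) := (integrable_const r).add (hs.const_mul _)
  have hG0 : ∀ p, 0 ≤ G p := fun p =>
    add_nonneg hr0 (mul_nonneg (by positivity) (add_nonneg (h01 _) (h01 _)))
  have hle : ∀ p, |finRankKernel m c E p - finRankKernel m a E' p| ≤ G p := by
    intro p
    by_cases hp : p.1 ∉ D ∧ p.2 ∉ D
    · have : finRankKernel m a E' p = finRankKernel m a E p :=
        Finset.sum_congr rfl fun i hi => by
          rw [hEE' _ hp.1 i (Finset.mem_range.1 hi), hEE' _ hp.2 i (Finset.mem_range.1 hi)]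
      rw [this]
      refine (abs_finRankKernel_sub_le hE p).trans (le_add_of_nonneg_right ?_)
      exact mul_nonneg (by positivity) (add_nonneg (h01 _) (h01 _))
    · have h1 : (1 : ℝ) ≤ D.indicator 1 p.1 + D.indicator 1 p.2 := by
        by_cases h : p.1 ∈ D
        · rw [Set.indicator_of_mem h]
          exact le_add_of_nonneg_right (h01 _)
        · have h' : p.2 ∈ D := by
            by_contra h'
            exact hp ⟨h, h'⟩
          rw [Set.indicator_of_mem h']
          exact le_add_of_nonneg_left (h01 _)
      have h2 := abs_finRankKernel_le (m := m) hc hE p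
      have h3 := abs_finRankKernel_le (m := m) ha hE' p
      have h4 : 2 * (m : ℝ) * 1 ≤ 2 * m * (D.indicator 1 p.1 + D.indicator 1 p.2) := by gcongr
      have h5 := abs_sub (finRankKernel m c E p) (finRankKernel m a E' p)
      simp only [hG]
      linarith
  calc |∫ p in A, (finRankKernel m c E p - finRankKernel m a E' p) ∂(P.prod P)|
      ≤ ∫ p in A, G p ∂(P.prod P) := by
        rw [← Real.norm_eq_abs]
        exact norm_integral_le_of_norm_le hGi.integrableOn (ae_of_all _ hle)
    _ ≤ ∫ p, G p ∂(P.prod P) := setIntegral_le_integral hGi (ae_of_all _ hG0)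
    _ = r + 4 * m * P.real D := by
        simp only [hG]
        rw [integral_add (integrable_const r) (hs.const_mul _),
          integral_const_mul, integral_add (hi.comp_fst P) (hi.comp_snd P),
          integral_fun_fst, integral_fun_snd, integral_indicator_one hD]
        simp
        ring

lemma abs_setIntegral_comp_le {Ω X : Type*} [MeasurableSpace Ω] [MeasurableSpace X]
    (P : Measure Ω) [IsProbabilityMeasure P] {Ψ : Ω → X} (hΨ : Measurable Ψ) {Φ : X × X → ℝ}
    (hΦ : Measurable Φ) {C : ℝ} (hC : ∀ p, |Φ p| ≤ C) {ε : ℝ}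
    (hε : ∀ S T : Set X, MeasurableSet S → MeasurableSet T →
      |∫ p in S ×ˢ T, Φ p ∂((P.map Ψ).prod (P.map Ψ))| ≤ ε)
    {A B : Set Ω} (hA : MeasurableSet A) (hB : MeasurableSet B) :
    |∫ p in A ×ˢ B, Φ (Ψ p.1, Ψ p.2) ∂(P.prod P)| ≤ ε := by
  have h01 : ∀ (D : Set Ω) u, D.indicator (1 : Ω → ℝ) u ∈ Set.Icc (0 : ℝ) 1 := fun D u => by
    by_cases h : u ∈ D <;> simp [h]
  have h := abs_integral_mul_mul_le P hΨ hΦ hC hε (measurable_one.indicator hA) (h01 A)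
    (measurable_one.indicator hB) (h01 B)
  rw [← integral_indicator (hA.prod hB)]
  refine le_of_eq_of_le (congrArg _ (integral_congr_ae (ae_of_all _ fun p => ?_))) h
  by_cases h1 : p.1 ∈ A <;> by_cases h2 : p.2 ∈ B <;> simp [Set.indicator, h1, h2]

/-- A kernel pulled back along codes is close to the limit kernel pulled back along the limit
code, if the codes agree up to a measure-preserving bijection. -/
lemma csDist_le_of_finRankKernel {X : Type*} [MeasurableSpace X] {W : USq → USq → ℝ}
    (hW : IsOrderon W) {V : X × X → ℝ} (hV : Measurable V) (hV01 : ∀ p, V p ∈ Set.Icc (0 : ℝ) 1)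
    {Ψ Ψ' : USq → X} (hΨ : Measurable Ψ) (hΨ' : Measurable Ψ') {m : ℕ} {c a : ℕ → ℝ}
    (hc : ∀ i, |c i| ≤ 1) (ha : ∀ i, |a i| ≤ 1) {e : ℕ → Bool → X → ℝ}
    (he : ∀ i b, Measurable (e i b)) (he01 : ∀ i b x, e i b x ∈ Set.Icc (0 : ℝ) 1) {ε : ℝ}
    (hcW : ∀ A B : Set USq, MeasurableSet A → MeasurableSet B →
      |∫ p in A ×ˢ B, (finRankKernel m c e (Ψ p.1, Ψ p.2) - W p.1 p.2)| ≤ ε)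
    (haV : ∀ S T : Set X, MeasurableSet S → MeasurableSet T →
      |∫ p in S ×ˢ T, (finRankKernel m a e p - V p)
        ∂(((volume : Measure USq).map Ψ').prod ((volume : Measure USq).map Ψ'))| ≤ ε)
    {f : USq → USq} (hf : IsMPB f) {D : Set USq} (hD : MeasurableSet D)
    (hfD : ∀ u ∉ D, ∀ i < m, ∀ b, e i b (Ψ u) = e i b (Ψ' (f u))) :
    csDist W (fun u v => V (Ψ' u, Ψ' v)) ≤ shiftOf f +
      (2 * ε + (∑ i ∈ Finset.range m, |c i - a i| + 4 * m * volume.real D)) := by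
  have hfm := hf.1.measurable
  have hmap : (volume : Measure USq).map (Ψ' ∘ f) = (volume : Measure USq).map Ψ' := by
    rw [← Measure.map_map hΨ' hfm, hf.1.map_eq]
  have hcK := measurable_finRankKernel m c he
  have haK := measurable_finRankKernel m a he
  have h1 : Integrable (fun p : USq × USq => finRankKernel m c e (Ψ p.1, Ψ p.2)) volume :=
    integrable_of_measurable_of_abs_le (by fun_prop) fun p => abs_finRankKernel_le hc he01 _
  have h2 : Integrable (fun p : USq × USq => finRankKernel m a e (Ψ' (f p.1), Ψ' (f p.2)))
      volume :=
    integrable_of_measurable_of_abs_le (by fun_prop) fun p => abs_finRankKernel_le ha he01 _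
  have h3 : Integrable (fun p : USq × USq => W p.1 p.2) volume :=
    integrable_of_measurable_of_abs_le (C := 1) hW.1 fun p => by
      rw [abs_of_nonneg (hW.2.1 _ _).1]; exact (hW.2.1 _ _).2
  have h4 : Integrable (fun p : USq × USq => V (Ψ' (f p.1), Ψ' (f p.2))) volume :=
    integrable_of_measurable_of_abs_le (C := 1) (by fun_prop) fun p => by
      rw [abs_of_nonneg (hV01 _).1]; exact (hV01 _).2
  refine csDist_le hf le_rfl fun S T hS hT => ?_
  have hsplit : ∫ p in S ×ˢ T, (W p.1 p.2 - V (Ψ' (f p.1), Ψ' (f p.2))) =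
      -(∫ p in S ×ˢ T, (finRankKernel m c e (Ψ p.1, Ψ p.2) - W p.1 p.2)) +
      (∫ p in S ×ˢ T, (finRankKernel m c e (Ψ p.1, Ψ p.2) -
        finRankKernel m a e (Ψ' (f p.1), Ψ' (f p.2)))) +
      ∫ p in S ×ˢ T, (finRankKernel m a e (Ψ' (f p.1), Ψ' (f p.2)) -
        V (Ψ' (f p.1), Ψ' (f p.2))) := by
    rw [integral_sub h3.integrableOn h4.integrableOn, integral_sub h1.integrableOn h3.integrableOn,
      integral_sub h1.integrableOn h2.integrableOn, integral_sub h2.integrableOn h4.integrableOn]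
    ring
  have b1 := hcW S T hS hT
  have b2 := abs_setIntegral_finRankKernel_sub_le_add (volume : Measure USq) hc ha
    (E := fun i b u => e i b (Ψ u)) (E' := fun i b u => e i b (Ψ' (f u)))
    (fun i b u => he01 i b _) (fun i b u => he01 i b _) hD hfD (S ×ˢ T)
  have b3 := abs_setIntegral_comp_le (volume : Measure USq) (hΨ'.comp hfm)
    (Φ := fun p => finRankKernel m a e p - V p) (haK.sub hV) (C := m + 1)
    (fun p => (abs_sub _ _).trans (add_le_add (abs_finRankKernel_le ha he01 p)
      (by rw [abs_of_nonneg (hV01 p).1]; exact (hV01 p).2)))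
    (by rw [hmap]; exact haV) hS hT
  rw [hsplit]
  refine (abs_add_three _ _ _).trans ?_
  rw [abs_neg]
  calc _ ≤ ε + (∑ i ∈ Finset.range m, |c i - a i| + 4 * m * volume.real D) + ε :=
        add_le_add (add_le_add b1 b2) b3
    _ = _ := by ring

/-- The code space: the first coordinate of a point together with countably many labels. -/
abbrev CodeSpace : Type := UI × (ℕ × ℕ × Bool → Bool)

/-- The indicator of a label on the code space. -/
def labelIndicator (k i : ℕ) (b : Bool) (x : CodeSpace) : ℝ := if x.2 (k, i, b) then 1 else 0

lemma continuous_labelIndicator (k i : ℕ) (b : Bool) : Continuous (labelIndicator k i b) :=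
  (continuous_of_discreteTopology (f := fun t : Bool => if t then (1 : ℝ) else 0)).comp
    ((continuous_apply (k, i, b)).comp continuous_snd)

lemma labelIndicator_mem_Icc (k i : ℕ) (b : Bool) (x : CodeSpace) :
    labelIndicator k i b x ∈ Set.Icc (0 : ℝ) 1 := by
  by_cases h : x.2 (k, i, b) <;> simp [labelIndicator, h]

/-- Every orderon is approximated in cut norm, at all scales simultaneously, by finite-rank kernels
in the labels of a measurable code which keeps the first coordinate. -/
lemma exists_code {W : USq → USq → ℝ} (hW : IsOrderon W) :
    ∃ (Ψ : USq → CodeSpace) (c : ℕ × ℕ → ℝ), Measurable Ψ ∧ (∀ u, (Ψ u).1 = u.1) ∧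
      (∀ j, |c j| ≤ 1) ∧ ∀ k : ℕ, ∀ A B : Set USq, MeasurableSet A → MeasurableSet B →
        |∫ p in A ×ˢ B, (finRankKernel ((k + 1) ^ 2 + 1) (fun i => c (k, i)) (labelIndicator k)
          (Ψ p.1, Ψ p.2) - W p.1 p.2)| ≤ 1 / ((k : ℝ) + 1) := by
  have hW1 : ∀ p : USq × USq, |W p.1 p.2| ≤ 1 := fun p => by
    rw [abs_of_nonneg (hW.2.1 _ _).1]; exact (hW.2.1 _ _).2
  have hWm : Measurable fun p : USq × USq => W p.1 p.2 := hW.1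
  have hsq : ∫ p : USq × USq, W p.1 p.2 ^ 2 ≤ 1 := by
    have := integral_mono (μ := (volume : Measure (USq × USq))) (f := fun p => W p.1 p.2 ^ 2)
      (g := fun _ => (1 : ℝ))
      (integrable_of_measurable_of_abs_le (C := 1) (by fun_prop) fun p => by
        rw [abs_pow]; exact pow_le_one₀ (abs_nonneg _) (hW1 p)) (integrable_const 1)
      (fun p => by
        beta_reduce
        rw [← sq_abs]
        exact pow_le_one₀ (abs_nonneg _) (hW1 p))
    simpa using this
  have key : ∀ k : ℕ, ∃ (c : ℕ → ℝ) (S T : ℕ → Set USq), (∀ i, |c i| ≤ 1) ∧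
      (∀ i, MeasurableSet (S i)) ∧ (∀ i, MeasurableSet (T i)) ∧ ∀ A B : Set USq,
      MeasurableSet A → MeasurableSet B → |∫ p in A ×ˢ B, (W p.1 p.2 -
        ∑ i ∈ Finset.range ((k + 1) ^ 2 + 1), c i * (S i ×ˢ T i).indicator 1 p)|
        ≤ 1 / ((k : ℝ) + 1) := fun k =>
    exists_rectangles_approx (volume : Measure USq) (by positivity) ((k + 1) ^ 2 + 1)
      (fun p => W p.1 p.2) hWm ⟨1, hW1⟩ hsq (by
        refine hsq.trans_lt ?_
        push_cast
        rw [div_pow, one_pow, mul_one_div, lt_div_iff₀ (by positivity)]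
        linarith)
  choose c S T hc hS hT h using key
  refine ⟨fun u => (u.1, fun j => decide (u ∈ if j.2.2 then T j.1 j.2.1 else S j.1 j.2.1)),
    fun j => c j.1 j.2, ?_, fun _ => rfl, fun j => hc _ _, fun k A B hA hB => ?_⟩
  · refine measurable_fst.prodMk (measurable_pi_iff.2 fun j => measurable_to_bool ?_)
    have : MeasurableSet (if j.2.2 then T j.1 j.2.1 else S j.1 j.2.1) := by
      split_ifs
      exacts [hT _ _, hS _ _]
    convert this using 1
    ext u
    simp
  · refine le_of_eq_of_le ?_ (h k A B hA hB)
    rw [← abs_neg, ← integral_neg]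
    refine congrArg _ (integral_congr_ae (ae_of_all _ fun p => ?_))
    simp only [neg_sub]
    refine congrArg _ (Finset.sum_congr rfl fun i _ => ?_)
    by_cases h1 : p.1 ∈ S k i <;> by_cases h2 : p.2 ∈ T k i <;>
      simp [labelIndicator, Set.indicator, h1, h2]

lemma fst_eq_volume_of_tendsto {Y : Type*} [TopologicalSpace Y] [MeasurableSpace Y]
    [OpensMeasurableSpace (UI × Y)] {P : ProbabilityMeasure USq}
    (hP : (P : Measure USq) = volume)
    {Ψ : ℕ → USq → UI × Y} (hΨ : ∀ n, Measurable (Ψ n)) (hfst : ∀ n u, (Ψ n u).1 = u.1)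
    {μ : ProbabilityMeasure (UI × Y)}
    (hμ : Tendsto (fun n => P.map (hΨ n).aemeasurable) atTop (nhds μ)) :
    (μ : Measure (UI × Y)).fst = volume := by
  have h := ((ProbabilityMeasure.continuous_map (continuous_fst (X := UI) (Y := Y))).tendsto
    μ).comp hμ
  have h' : ∀ n, (P.map (hΨ n).aemeasurable).map
      (continuous_fst (X := UI) (Y := Y)).measurable.aemeasurable =
      P.map (measurable_fst (α := UI) (β := UI)).aemeasurable := by
    intro n
    apply Subtype.ext
    change ((P : Measure USq).map (Ψ n)).map Prod.fst = (P : Measure USq).map Prod.fst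
    rw [Measure.map_map measurable_fst (hΨ n)]
    congr 1
    exact funext (hfst n)
  have h'' := tendsto_nhds_unique (h.congr h') tendsto_const_nhds
  have := congrArg (fun ν : ProbabilityMeasure UI => (ν : Measure UI)) h''
  change (μ : Measure (UI × Y)).map Prod.fst = (P : Measure USq).map Prod.fst at this
  rw [Measure.fst, this, hP]
  exact measurePreserving_fst.map_eq

/-- The labels with first index `k` and second index below `m`. -/
def labels (k m : ℕ) (x : CodeSpace) (j : Fin m × Bool) : Bool := x.2 (k, j.1, j.2)

lemma measurable_labels (k m : ℕ) : Measurable (labels k m) :=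
  measurable_pi_iff.2 fun j => (measurable_pi_apply (k, (j.1 : ℕ), j.2)).comp measurable_snd

lemma tendsto_sum_abs_measureReal_labels_sub {P : ProbabilityMeasure USq}
    (hP : (P : Measure USq) = volume) {Ψ : ℕ → USq → CodeSpace} (hΨ : ∀ n, Measurable (Ψ n))
    (hfst : ∀ n u, (Ψ n u).1 = u.1) {Ψ' : USq → CodeSpace} (hΨ' : Measurable Ψ')
    (hfst' : ∀ u, (Ψ' u).1 = u.1) {μ : ProbabilityMeasure CodeSpace}
    (hμ : Tendsto (fun n => P.map (hΨ n).aemeasurable) atTop (nhds μ))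
    (hμ1 : (μ : Measure CodeSpace).fst = volume)
    (hmap : (volume : Measure USq).map Ψ' = μ) (N : ℕ) [NeZero N] (k m : ℕ) :
    Tendsto (fun n => ∑ i, ∑ q,
      |volume.real ({u | (gridCell N u).1 = i} ∩ (fun u => labels k m (Ψ n u)) ⁻¹' {q}) -
        volume.real ({u | (gridCell N u).1 = i} ∩ (fun u => labels k m (Ψ' u)) ⁻¹' {q})|)
      atTop (nhds 0) := by
  have hmeas : ∀ i : Fin N, MeasurableSet {x : UI | Fin.ofNat N ⌊N * (x : ℝ)⌋₊ = i} := fun i =>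
    (measurable_from_nat (f := fun t : ℕ => Fin.ofNat N t)).comp
      (Nat.measurable_floor.comp (measurable_const.mul measurable_subtype_coe))
      (measurableSet_singleton i)
  have hC : ∀ q : Fin m × Bool → Bool,
      IsClopen {y : ℕ × ℕ × Bool → Bool | ∀ j : Fin m × Bool, y (k, j.1, j.2) = q j} := fun q => by
    simp only [Set.ofPred_forall]
    exact isClopen_iInter_of_finite fun j =>
      (isClopen_discrete {q j}).preimage (continuous_apply (k, (j.1 : ℕ), j.2))
  have hset : ∀ {Φ : USq → CodeSpace} (_ : Measurable Φ) (_ : ∀ u, (Φ u).1 = u.1) (i : Fin N)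
      (q : Fin m × Bool → Bool),
      volume.real ({u | (gridCell N u).1 = i} ∩ (fun u => labels k m (Φ u)) ⁻¹' {q}) =
        ((volume : Measure USq).map Φ).real ({x : UI | Fin.ofNat N ⌊N * (x : ℝ)⌋₊ = i} ×ˢ
          {y : ℕ × ℕ × Bool → Bool | ∀ j : Fin m × Bool, y (k, j.1, j.2) = q j}) := by
    intro Φ hΦ hΦ1 i q
    rw [map_measureReal_apply hΦ ((hmeas i).prod (hC q).1.measurableSet)]
    congr 1
    ext u
    simp only [Set.mem_inter_iff, Set.mem_preimage, Set.mem_prod, Set.mem_ofPred_eq, hΦ1,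
      Set.mem_singleton_iff, funext_iff]
    rfl
  rw [← Finset.sum_const_zero (s := (Finset.univ : Finset (Fin N)))]
  refine tendsto_finsetSum _ fun i _ => ?_
  rw [← Finset.sum_const_zero (s := (Finset.univ : Finset (Fin m × Bool → Bool)))]
  refine tendsto_finsetSum _ fun q _ => ?_
  rw [← abs_zero (α := ℝ)]
  refine Tendsto.abs ?_
  have h := tendsto_measureReal_strip_prod hμ hμ1 N i (hC q)
  rw [hset hΨ' hfst', hmap]
  refine ((tendsto_sub_nhds_zero_iff).2 h).congr fun n => ?_
  rw [hset (hΨ n) (hfst n), ← hP]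
  rfl

/-- Sequential compactness of the space of orderons with respect to the
cut-shift distance. -/
theorem orderon_compactness (W : ℕ → (USq → USq → ℝ)) (hW : ∀ n, IsOrderon (W n)) :
    ∃ φ : ℕ → ℕ, StrictMono φ ∧ ∃ U : USq → USq → ℝ, IsOrderon U ∧
      Tendsto (fun j => csDist (W (φ j)) U) atTop (nhds 0) := by
  choose Ψ c hΨ hfst hc hcW using fun n => exists_code (hW n)
  let P : ProbabilityMeasure USq := ⟨volume, inferInstance⟩
  obtain ⟨φ, hφ, μ, a, V, hV, hV01, hVs, hμ, hca, hWV⟩ :=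
    exists_subseq_limit_kernel P (fun n => (hW n).1) (fun n => (hW n).2.1) (fun n => (hW n).2.2)
      hΨ (ι := ℕ × ℕ) (c := c) hc
  have hμ1 : (μ : Measure CodeSpace).fst = volume :=
    fst_eq_volume_of_tendsto (P := P) rfl (fun n => hΨ (φ n)) (fun n => hfst (φ n)) hμ
  obtain ⟨Ψ', hΨ', hfst', hmap⟩ := exists_measurable_map_eq_of_fst_eq (μ : Measure CodeSpace) hμ1
  have ha : ∀ j, |a j| ≤ 1 := fun j =>
    le_of_tendsto ((hca j).abs) (Eventually.of_forall fun n => hc (φ n) j)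
  refine ⟨φ, hφ, fun u v => V (Ψ' u, Ψ' v), ⟨by
    change Measurable fun p : USq × USq => V (Ψ' p.1, Ψ' p.2)
    fun_prop, fun _ _ => hV01 _, fun _ _ => hVs _ _⟩, ?_⟩
  have haV : ∀ k : ℕ, ∀ S T : Set CodeSpace, MeasurableSet S → MeasurableSet T →
      |∫ p in S ×ˢ T, (finRankKernel ((k + 1) ^ 2 + 1) (fun i => a (k, i)) (labelIndicator k) p
        - V p) ∂((μ : Measure CodeSpace).prod μ)| ≤ 1 / ((k : ℝ) + 1) := fun k S T hS hT =>
    abs_setIntegral_finRankKernel_sub_le P (W := fun n p => W (φ n) p.1 p.2)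
      (fun n => (hW (φ n)).1) (fun n _ => (hW (φ n)).2.1 _ _) (fun n => hΨ (φ n))
      (c := fun n i => c (φ n) (k, i)) (fun n i => hc (φ n) _) (fun i => hca (k, i))
      (continuous_labelIndicator k) (labelIndicator_mem_Icc k) hμ hV hV01 hWV
      (fun n A B hA hB => hcW (φ n) k A B hA hB) hS hT
  rw [Metric.tendsto_nhds]
  intro ε hε
  obtain ⟨k, hk⟩ := exists_nat_one_div_lt (show 0 < ε / 12 by positivity)
  set m := (k + 1) ^ 2 + 1 with hm
  have hm0 : (0 : ℝ) < m := by positivity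
  set δ : ℝ := ε / (16 * m) with hδ
  have hδ0 : 0 < δ := by positivity
  have hlim := ((tendsto_finsetSum (Finset.range m) fun i _ =>
    (tendsto_sub_nhds_zero_iff.2 (hca (k, i))).abs).add
    ((tendsto_sum_abs_measureReal_labels_sub (P := P) rfl (fun n => hΨ (φ n))
      (fun n => hfst (φ n)) hΨ' hfst' hμ hμ1 hmap (k + 1) k m).const_mul (4 * (m : ℝ))))
  simp only [abs_zero, Finset.sum_const_zero, mul_zero, add_zero] at hlim
  filter_upwards [hlim.eventually_lt_const (show 0 < ε / 4 by positivity)] with n hn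
  obtain ⟨f, hf, hshift, hne⟩ := exists_isMPB_measureReal_ne_le
    ((measurable_labels k m).comp (hΨ (φ n))) ((measurable_labels k m).comp hΨ') (k + 1) hδ0
  have hD : MeasurableSet {u | (labels k m ∘ Ψ') (f u) ≠ (labels k m ∘ Ψ (φ n)) u} :=
    (measurableSet_eq_fun (((measurable_labels k m).comp hΨ').comp hf.1.measurable)
      ((measurable_labels k m).comp (hΨ (φ n)))).compl
  have hcs := csDist_le_of_finRankKernel (hW (φ n)) hV hV01 (hΨ (φ n)) hΨ' (m := m)
    (c := fun i => c (φ n) (k, i)) (a := fun i => a (k, i)) (fun i => hc (φ n) _) (fun i => ha _)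
    (fun i b => (continuous_labelIndicator k i b).measurable) (labelIndicator_mem_Icc k)
    (hcW (φ n) k) (by rw [hmap]; exact haV k) hf hD (fun u hu i hi b => by
      simp only [Set.mem_ofPred_eq, not_not] at hu
      have := congrFun hu (⟨i, hi⟩, b)
      simp only [Function.comp_apply, labels] at this
      simp only [labelIndicator, this])
  rw [Real.dist_0_eq_abs, abs_of_nonneg (csDist_nonneg _ _)]
  refine hcs.trans_lt ?_
  push_cast at hshift
  have h1 := mul_le_mul_of_nonneg_left hne (show 0 ≤ 4 * (m : ℝ) by positivity)
  have h2 : 4 * (m : ℝ) * δ = ε / 4 := by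
    rw [hδ]
    field_simp
    norm_num
  rw [mul_add, h2] at h1
  simp only [Function.comp_def] at h1 ⊢
  linarith
end
end

section
/- Let U be an orderon and let φ ∈ ℱ be a measure-preserving bijection of [0,1]^2. Then for every simple ordered graph F on k vertices, |t(F,U) − t(F,U^φ)| ≤ 4·k!·(k choose 2)·Shift(φ). -/
open MeasureTheory Real Filter
open scoped ENNReal Classical

noncomputable section

/-- The (induced) homomorphism density `t(F,W)` of a simple ordered graph `F` on `[k]`
(encoded as a `SimpleGraph (Fin k)`, the vertex order being that of `Fin k`) in `W`. -/
def homDensity {k : ℕ} (F : SimpleGraph (Fin k)) (W : USq → USq → ℝ) : ℝ :=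
  (k.factorial : ℝ) * ∫ v : Fin k → USq,
    ∏ p ∈ Finset.univ.filter (fun p : Fin k × Fin k => p.1 < p.2),
      ((if F.Adj p.1 p.2 then W (v p.1) (v p.2) else 1 - W (v p.1) (v p.2)) *
        (if ((v p.1).1 : ℝ) ≤ ((v p.2).1 : ℝ) then 1 else 0))

lemma abs_shift_le (f : USq → USq) (u : USq) :
    |(u.1 : ℝ) - ((f u).1 : ℝ)| ≤ shiftOf f := by
  refine le_ciSup (f := fun u : USq => |(u.1 : ℝ) - ((f u).1 : ℝ)|) ⟨1, ?_⟩ u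
  rintro _ ⟨w, rfl⟩
  have h₁ := w.1.2
  have h₂ := (f w).1.2
  exact abs_le.2 ⟨by linarith [h₁.1, h₂.2], by linarith [h₁.2, h₂.1]⟩

lemma abs_prod_sub_prod_le_sum {ι : Type*} (s : Finset ι) (a b : ι → ℝ)
    (ha : ∀ i, a i ∈ Set.Icc (0 : ℝ) 1) (hb : ∀ i, b i ∈ Set.Icc (0 : ℝ) 1) :
    |∏ i ∈ s, a i - ∏ i ∈ s, b i| ≤ ∑ i ∈ s, |a i - b i| := by
  induction s using Finset.induction_on with
  | empty => simp
  | insert i s hi ih =>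
    rw [Finset.prod_insert hi, Finset.prod_insert hi, Finset.sum_insert hi]
    have hA₀ : 0 ≤ ∏ j ∈ s, a j := Finset.prod_nonneg fun j _ => (ha j).1
    have hA₁ : ∏ j ∈ s, a j ≤ 1 :=
      Finset.prod_le_one (fun j _ => (ha j).1) fun j _ => (ha j).2
    calc |a i * ∏ j ∈ s, a j - b i * ∏ j ∈ s, b j|
        = |(a i - b i) * ∏ j ∈ s, a j + b i * (∏ j ∈ s, a j - ∏ j ∈ s, b j)| := by
          congr 1; ring
      _ ≤ |a i - b i| * ∏ j ∈ s, a j + b i * |∏ j ∈ s, a j - ∏ j ∈ s, b j| := by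
          refine (abs_add_le _ _).trans_eq ?_
          rw [abs_mul, abs_mul, abs_of_nonneg hA₀, abs_of_nonneg (hb i).1]
      _ ≤ |a i - b i| + ∑ j ∈ s, |a j - b j| :=
          add_le_add (mul_le_of_le_one_right (abs_nonneg _) hA₁)
            ((mul_le_of_le_one_left (abs_nonneg _) (hb i).2).trans ih)

lemma volume_abs_sub_le (x : UI) (r : ℝ) :
    volume {y : UI | |(x : ℝ) - y| ≤ r} ≤ ENNReal.ofReal (2 * r) := by
  have hs : {y : UI | |(x : ℝ) - y| ≤ r} =
      Subtype.val ⁻¹' Metric.closedBall (x : ℝ) r := by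
    ext y
    simp [Subtype.dist_eq, Real.dist_eq, abs_sub_comm (x : ℝ)]
  rw [hs, ← Real.volume_closedBall (x : ℝ) r, volume_set_coe_def,
    comap_subtype_coe_apply measurableSet_Icc, Subtype.image_preimage_coe]
  exact measure_mono Set.inter_subset_right

lemma prod_volume_abs_sub_le (r : ℝ) :
    (volume : Measure UI).prod volume {p : UI × UI | |(p.1 : ℝ) - p.2| ≤ r} ≤
      ENNReal.ofReal (2 * r) := by
  have hm : MeasurableSet {p : UI × UI | |(p.1 : ℝ) - p.2| ≤ r} :=
    measurableSet_le (by fun_prop) measurable_const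
  rw [Measure.prod_apply hm]
  calc ∫⁻ x : UI, volume (Prod.mk x ⁻¹' {p : UI × UI | |(p.1 : ℝ) - p.2| ≤ r})
      ≤ ∫⁻ _ : UI, ENNReal.ofReal (2 * r) := lintegral_mono fun x => volume_abs_sub_le x r
    _ = ENNReal.ofReal (2 * r) := by simp

lemma map_fst_eval_pair {k : ℕ} {i j : Fin k} (hij : i ≠ j) :
    (volume : Measure (Fin k → USq)).map (fun v => ((v i).1, (v j).1)) =
      (volume : Measure UI).prod volume := by
  have hind := (ProbabilityTheory.iIndepFun_pi (μ := fun _ : Fin k => (volume : Measure USq))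
    (X := fun _ u => u.1) fun _ => measurable_fst.aemeasurable).indepFun hij
  have hmap (l : Fin k) :
      (volume : Measure (Fin k → USq)).map (fun v => (v l).1) = (volume : Measure UI) :=
    (measurePreserving_fst.comp
      (measurePreserving_eval (fun _ : Fin k => (volume : Measure USq)) l)).map_eq
  have h := (ProbabilityTheory.indepFun_iff_map_prod_eq_prod_map_map
    (measurable_fst.comp (measurable_pi_apply i)).aemeasurable
    (measurable_fst.comp (measurable_pi_apply j)).aemeasurable).1 hind
  exact h.trans (congrArg₂ Measure.prod (hmap i) (hmap j))

lemma measurableSet_abs_fst_sub_le {k : ℕ} (i j : Fin k) (r : ℝ) :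
    MeasurableSet {v : Fin k → USq | |((v i).1 : ℝ) - (v j).1| ≤ r} :=
  measurableSet_le (by fun_prop) measurable_const

lemma volume_real_abs_fst_sub_le {k : ℕ} {i j : Fin k} (hij : i ≠ j) {r : ℝ} (hr : 0 ≤ r) :
    (volume : Measure (Fin k → USq)).real {v | |((v i).1 : ℝ) - (v j).1| ≤ r} ≤ 2 * r := by
  refine ENNReal.toReal_le_of_le_ofReal (by positivity) ?_
  have h := prod_volume_abs_sub_le r
  rwa [← map_fst_eval_pair hij, Measure.map_apply (by fun_prop)
    (measurableSet_le (by fun_prop) measurable_const)] at h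

lemma abs_order_indicator_sub_le {x y x' y' s : ℝ} (hx : |x - x'| ≤ s) (hy : |y - y'| ≤ s) :
    |(if x' ≤ y' then (1 : ℝ) else 0) - (if x ≤ y then 1 else 0)| ≤
      if |x - y| ≤ 2 * s then 1 else 0 := by
  rw [abs_le] at hx hy
  split_ifs with h₁ h₂ h₃ h₃ h₃ h₃ <;> norm_num <;> apply h₃ <;> rw [abs_le] <;>
    constructor <;> linarith

lemma card_filter_lt_fin (k : ℕ) :
    (Finset.univ.filter fun p : Fin k × Fin k => p.1 < p.2).card = k.choose 2 := by
  simpa using Finset.card_product_filter_lt (s := (Finset.univ : Finset (Fin k)))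

/-- The contribution of a single pair of vertices to the integrand of `homDensity`. -/
def pairFactor {k : ℕ} (F : SimpleGraph (Fin k)) (W : USq → USq → ℝ) (v : Fin k → USq)
    (p : Fin k × Fin k) : ℝ :=
  if F.Adj p.1 p.2 then W (v p.1) (v p.2) else 1 - W (v p.1) (v p.2)

/-- The indicator that the pair `p` of vertices is placed in increasing order. -/
def orderFactor {k : ℕ} (v : Fin k → USq) (p : Fin k × Fin k) : ℝ :=
  if ((v p.1).1 : ℝ) ≤ ((v p.2).1 : ℝ) then 1 else 0

/-- The integrand of `homDensity`. -/
def homIntegrand {k : ℕ} (F : SimpleGraph (Fin k)) (W : USq → USq → ℝ) (v : Fin k → USq) : ℝ :=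
  ∏ p ∈ Finset.univ.filter (fun p : Fin k × Fin k => p.1 < p.2),
    pairFactor F W v p * orderFactor v p

section

variable {k : ℕ} (F : SimpleGraph (Fin k)) {W : USq → USq → ℝ}

lemma pairFactor_mem_Icc (hW : ∀ u v, W u v ∈ Set.Icc (0 : ℝ) 1) (v : Fin k → USq)
    (p : Fin k × Fin k) : pairFactor F W v p ∈ Set.Icc (0 : ℝ) 1 := by
  have h := hW (v p.1) (v p.2)
  unfold pairFactor
  split_ifs
  · exact h
  · exact ⟨by linarith [h.2], by linarith [h.1]⟩

lemma orderFactor_mem_Icc (v : Fin k → USq) (p : Fin k × Fin k) :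
    orderFactor v p ∈ Set.Icc (0 : ℝ) 1 := by
  unfold orderFactor
  split_ifs <;> simp

lemma pairFactor_mul_orderFactor_mem_Icc (hW : ∀ u v, W u v ∈ Set.Icc (0 : ℝ) 1)
    (v w : Fin k → USq) (p : Fin k × Fin k) :
    pairFactor F W v p * orderFactor w p ∈ Set.Icc (0 : ℝ) 1 := by
  have h₁ := pairFactor_mem_Icc F hW v p
  have h₂ := orderFactor_mem_Icc w p
  exact ⟨mul_nonneg h₁.1 h₂.1, mul_le_one₀ h₁.2 h₂.1 h₂.2⟩

lemma measurable_homIntegrand (hW : Measurable (Function.uncurry W)) :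
    Measurable (homIntegrand F W) := by
  refine Finset.measurable_prod _ fun p _ => Measurable.mul ?_ ?_
  · have h : Measurable fun v : Fin k → USq => W (v p.1) (v p.2) :=
      hW.comp (g := Function.uncurry W) (f := fun v : Fin k → USq => (v p.1, v p.2))
        ((measurable_pi_apply p.1).prodMk (measurable_pi_apply p.2))
    unfold pairFactor
    split_ifs
    · exact h
    · exact measurable_const.sub h
  · exact Measurable.ite (measurableSet_le (by fun_prop) (by fun_prop))
      measurable_const measurable_const

lemma integrable_homIntegrand (hm : Measurable (Function.uncurry W))
    (hW : ∀ u v, W u v ∈ Set.Icc (0 : ℝ) 1) : Integrable (homIntegrand F W) := by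
  refine Integrable.of_bound (measurable_homIntegrand F hm).aestronglyMeasurable 1
    (ae_of_all _ fun v => ?_)
  have h := pairFactor_mul_orderFactor_mem_Icc F hW v v
  rw [Real.norm_eq_abs, homIntegrand, abs_of_nonneg (Finset.prod_nonneg fun p _ => (h p).1)]
  exact Finset.prod_le_one (fun p _ => (h p).1) fun p _ => (h p).2

/-- Transporting all the sampled points by `φ` changes the integrand only where some pair of
points has first coordinates within twice the shift of each other. -/
lemma abs_homIntegrand_comp_sub_le (hW : ∀ u v, W u v ∈ Set.Icc (0 : ℝ) 1) (φ : USq → USq)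
    (v : Fin k → USq) :
    |homIntegrand F W (fun i => φ (v i)) - homIntegrand F (fun u w => W (φ u) (φ w)) v| ≤
      ∑ p ∈ Finset.univ.filter (fun p : Fin k × Fin k => p.1 < p.2),
        {v : Fin k → USq | |((v p.1).1 : ℝ) - (v p.2).1| ≤ 2 * shiftOf φ}.indicator 1 v := by
  refine (abs_prod_sub_prod_le_sum _ _ _
    (pairFactor_mul_orderFactor_mem_Icc F hW (fun i => φ (v i)) _)
    (pairFactor_mul_orderFactor_mem_Icc F (fun _ _ => hW _ _) v v)).trans
    (Finset.sum_le_sum fun p _ => ?_)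
  have hpf : pairFactor F (fun u w => W (φ u) (φ w)) v p =
      pairFactor F W (fun i => φ (v i)) p := rfl
  have h := pairFactor_mem_Icc F hW (fun i => φ (v i)) p
  rw [hpf, ← mul_sub, abs_mul, abs_of_nonneg h.1]
  refine (mul_le_of_le_one_left (abs_nonneg _) h.2).trans ?_
  exact (abs_order_indicator_sub_le (abs_shift_le φ (v p.1)) (abs_shift_le φ (v p.2))).trans_eq
    (by simp [Set.indicator_apply])

lemma integral_homIntegrand_comp (hm : Measurable (Function.uncurry W)) {φ : USq → USq}
    (hφ : MeasurePreserving φ volume volume) :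
    ∫ v : Fin k → USq, homIntegrand F W (fun i => φ (v i)) = ∫ v, homIntegrand F W v := by
  have hp : MeasurePreserving (fun (v : Fin k → USq) i => φ (v i)) volume volume :=
    volume_preserving_pi fun _ => hφ
  conv_rhs => rw [← hp.map_eq]
  exact (integral_map hp.aemeasurable (measurable_homIntegrand F hm).aestronglyMeasurable).symm

end

/-- Shift lemma: `|t(F,U) - t(F,U^φ)| ≤ 4·k!·(k choose 2)·Shift(φ)` for any
measure-preserving bijection `φ` of `[0,1]²`. -/
theorem counting_lemma_shift {k : ℕ} (F : SimpleGraph (Fin k))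
    (U : USq → USq → ℝ) (hU : IsOrderon U)
    (φ : USq → USq) (hφ : IsMPB φ) :
    |homDensity F U - homDensity F (fun u v => U (φ u) (φ v))| ≤
      4 * (k.factorial : ℝ) * (k.choose 2 : ℝ) * shiftOf φ := by
  obtain ⟨hm, hI, -⟩ := hU
  have hmp := hφ.1
  have hm' : Measurable (Function.uncurry fun u v => U (φ u) (φ v)) :=
    hm.comp (hmp.measurable.prodMap hmp.measurable)
  have hp : MeasurePreserving (fun (v : Fin k → USq) i => φ (v i)) volume volume :=
    volume_preserving_pi fun _ => hmp
  have hF : Integrable fun v : Fin k → USq => homIntegrand F U (fun i => φ (v i)) :=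
    hp.integrable_comp_of_integrable (integrable_homIntegrand F hm hI)
  have hF' := integrable_homIntegrand F hm' fun _ _ => hI _ _
  have hind (p : Fin k × Fin k) :
      Integrable ({v : Fin k → USq |
        |((v p.1).1 : ℝ) - (v p.2).1| ≤ 2 * shiftOf φ}.indicator (1 : (Fin k → USq) → ℝ)) :=
    (integrable_const (1 : ℝ)).indicator (measurableSet_abs_fst_sub_le p.1 p.2 _)
  have key : |(∫ v, homIntegrand F U v) -
      ∫ v, homIntegrand F (fun u v => U (φ u) (φ v)) v| ≤ k.choose 2 * (4 * shiftOf φ) := by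
    rw [← integral_homIntegrand_comp F hm hmp, ← integral_sub hF hF']
    refine (abs_integral_le_integral_abs).trans ((integral_mono (hF.sub hF').abs
      (integrable_finsetSum _ fun p _ => hind p)
      (abs_homIntegrand_comp_sub_le F hI φ)).trans ?_)
    rw [integral_finsetSum _ fun p _ => hind p, ← card_filter_lt_fin, ← nsmul_eq_mul]
    refine Finset.sum_le_card_nsmul _ _ _ fun p hp => ?_
    rw [integral_indicator_one (measurableSet_abs_fst_sub_le p.1 p.2 _)]
    have h := volume_real_abs_fst_sub_le (Finset.mem_filter.1 hp).2.ne
      (mul_nonneg zero_le_two (shiftOf_nonneg φ))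
    linarith
  change |(k.factorial : ℝ) * (∫ v, homIntegrand F U v) -
    k.factorial * ∫ v, homIntegrand F (fun u v => U (φ u) (φ v)) v| ≤ _
  rw [← mul_sub, abs_mul, Nat.abs_cast]
  exact (mul_le_mul_of_nonneg_left key (Nat.cast_nonneg _)).trans_eq (by ring)
end
end
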